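/- arXiv:1811.05674 — 3 statements merged into one kernel-verified Lean document; each statement's English description precedes it below -/
import Mathlib

section
/- Let a_0 < a_1 < ⋯ < a_n be real numbers, let c_{a_0}, …, c_{a_n} > 0, l > 0, and weights ω_{a_0}, …, ω_{a_n} > 0, let 𝒯_{a_i} be the rational GT-Bernstein basis functions, let a_0 ≤ t_0 < t_1 < ⋯ < t_n ≤ a_n, and let M = [𝒯_{a_j}(t_i)]_{i,j=0}^{n} be the collocation matrix. Then every eigenvalue λ ∈ ℂ of M (viewed as a complex matrix) is real and satisfies 0 < λ ≤ 1. -/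
open Finset

def SAlt {ι : Type*} [LinearOrder ι] (k : ℕ) (x : ι → ℝ) : Prop :=
  ∃ j : Fin (k + 1) → ι, StrictMono j ∧ ∀ p : Fin (k + 1), 0 < (-1 : ℝ) ^ (p : ℕ) * x (j p)

def WAlt {ι : Type*} [LinearOrder ι] (k : ℕ) (x : ι → ℝ) : Prop :=
  ∃ j : Fin (k + 1) → ι, StrictMono j ∧ ∀ p : Fin (k + 1), 0 ≤ (-1 : ℝ) ^ (p : ℕ) * x (j p)

theorem strictMono_const_aux {ι : Type*} [LinearOrder ι] (i : ι) :
    StrictMono (fun _ : Fin (0 + 1) => i) := by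
  intro p q h
  rw [Fin.lt_def] at h
  omega

theorem strictMono_cons_aux {ι : Type*} [LinearOrder ι] {k : ℕ} (i : ι) (j : Fin (k + 1) → ι)
    (hj : StrictMono j) (h : i < j 0) :
    StrictMono (Fin.cons i j : Fin (k + 1 + 1) → ι) := by
  rw [Fin.strictMono_iff_lt_succ] at hj ⊢
  intro p
  refine Fin.cases ?_ (fun q => ?_) p
  · simpa using h
  · rw [← Fin.succ_castSucc]
    simpa using hj q

theorem SAlt_cons {ι : Type*} [LinearOrder ι] {k : ℕ} (x : ι → ℝ) (i : ι) (j : Fin (k + 1) → ι)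
    (hj : StrictMono j) (h : i < j 0) (hi : 0 < x i)
    (hx : ∀ p : Fin (k + 1), 0 < (-1 : ℝ) ^ (p : ℕ) * (-x (j p))) : SAlt (k + 1) x := by
  refine ⟨Fin.cons i j, strictMono_cons_aux i j hj h, fun p => ?_⟩
  refine Fin.cases ?_ (fun q => ?_) p
  · simpa using hi
  · have := hx q
    simp only [Fin.val_succ, Fin.cons_succ, pow_succ]
    linarith

theorem WAlt_cons {ι : Type*} [LinearOrder ι] {k : ℕ} (x : ι → ℝ) (i : ι) (j : Fin (k + 1) → ι)
    (hj : StrictMono j) (h : i < j 0) (hi : 0 ≤ x i)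
    (hx : ∀ p : Fin (k + 1), 0 < (-1 : ℝ) ^ (p : ℕ) * (-x (j p))) : WAlt (k + 1) x := by
  refine ⟨Fin.cons i j, strictMono_cons_aux i j hj h, fun p => ?_⟩
  refine Fin.cases ?_ (fun q => ?_) p
  · simpa using hi
  · have := hx q
    simp only [Fin.val_succ, Fin.cons_succ, pow_succ]
    linarith

theorem SAlt.weak {ι : Type*} [LinearOrder ι] {k : ℕ} {x : ι → ℝ} (h : SAlt k x) : WAlt k x := by
  obtain ⟨j, hj, h⟩ := h
  exact ⟨j, hj, fun p => (h p).le⟩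

theorem SAlt_merge {ι : Type*} [LinearOrder ι] {k : ℕ} {x : ι → ℝ} (h : SAlt k x)
    (h' : SAlt k (-x)) : SAlt (k + 1) x ∨ SAlt (k + 1) (-x) := by
  obtain ⟨i, hi, hix⟩ := h
  obtain ⟨j, hj, hjx⟩ := h'
  have hi0 := hix 0
  have hj0 := hjx 0
  simp at hi0 hj0
  rcases lt_trichotomy (i 0) (j 0) with h | h | h
  · left
    exact SAlt_cons x (i 0) j hj h hi0 hjx
  · rw [h] at hi0; linarith
  · right
    refine SAlt_cons (-x) (j 0) i hi h (by simpa using hj0) (fun p => ?_)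
    simpa using hix p

theorem not_SAlt_card {ι : Type*} [LinearOrder ι] [Fintype ι] {x : ι → ℝ} :
    ¬ SAlt (Fintype.card ι) x := by
  rintro ⟨j, hj, -⟩
  have := Fintype.card_le_of_injective j hj.injective
  simp at this

theorem exists_pos_of_SAlt {ι : Type*} [LinearOrder ι] {k : ℕ} {x : ι → ℝ} (h : SAlt k x) :
    x ≠ 0 := by
  rintro rfl
  obtain ⟨j, -, h⟩ := h
  simpa using h 0

/-- Variation diminishing property of exponential sums. -/
theorem exp_vd {ι : Type*} [LinearOrder ι] [Fintype ι] (α : ι → ℝ) (hα : StrictMono α) (k : ℕ) :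
    ∀ (c : ι → ℝ), c ≠ 0 → ∀ y : Fin (k + 1) → ℝ, StrictMono y →
      (∀ p : Fin (k + 1), 0 ≤ (-1 : ℝ) ^ (p : ℕ) * ∑ j, c j * Real.exp (α j * y p)) → SAlt k c := by
  induction k with
  | zero =>
    intro c hc y hy h
    by_contra hcon
    have hneg : ∀ j, c j ≤ 0 := by
      intro j
      by_contra hj
      push Not at hj
      exact hcon ⟨fun _ => j, strictMono_const_aux _, fun p => by simpa using hj⟩
    obtain ⟨j0, hj0⟩ := Function.ne_iff.mp hc
    have : ∑ j, c j * Real.exp (α j * y 0) < 0 := by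
      apply Finset.sum_neg'
      · intro i _
        exact mul_nonpos_of_nonpos_of_nonneg (hneg i) (Real.exp_pos _).le
      · exact ⟨j0, mem_univ _, mul_neg_of_neg_of_pos (lt_of_le_of_ne (hneg j0) hj0)
          (Real.exp_pos _)⟩
    have h0 := h 0
    simp at h0
    linarith
  | succ k ih =>
    intro c hc y hy h
    -- first positive coefficient
    have hpos : ∃ j, 0 < c j := by
      by_contra hcon
      push Not at hcon
      obtain ⟨j0, hj0⟩ := Function.ne_iff.mp hc
      have : ∑ j, c j * Real.exp (α j * y 0) < 0 := by
        apply Finset.sum_neg'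
        · intro i _
          exact mul_nonpos_of_nonpos_of_nonneg (hcon i) (Real.exp_pos _).le
        · exact ⟨j0, mem_univ _, mul_neg_of_neg_of_pos (lt_of_le_of_ne (hcon j0) hj0)
            (Real.exp_pos _)⟩
      have h0 := h 0
      simp at h0
      linarith
    obtain ⟨s, hs, hsmin⟩ := Finset.exists_min_image (univ.filter fun j => 0 < c j) id
      (by obtain ⟨j, hj⟩ := hpos; exact ⟨j, by simpa using hj⟩)
    have hcs : 0 < c s := by simpa using hs
    have hlt : ∀ j, j < s → c j ≤ 0 := by
      intro j hj
      by_contra hc'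
      push Not at hc'
      exact absurd (hsmin j (by simpa using hc')) (by simpa using hj)
    set g : ℝ → ℝ := fun u => ∑ j, c j * Real.exp ((α j - α s) * u) with hg
    have hgf : ∀ u, g u = Real.exp (-(α s * u)) * ∑ j, c j * Real.exp (α j * u) := by
      intro u
      rw [hg, Finset.mul_sum]
      refine Finset.sum_congr rfl fun j _ => ?_
      rw [mul_left_comm, ← Real.exp_add]
      congr 2
      ring
    have hgalt : ∀ p : Fin (k + 1 + 1), 0 ≤ (-1 : ℝ) ^ (p : ℕ) * g (y p) := by
      intro p
      rw [hgf, mul_left_comm]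
      exact mul_nonneg (Real.exp_pos _).le (h p)
    have hder : ∀ u, HasDerivAt g (∑ j, (c j * (α j - α s)) * Real.exp ((α j - α s) * u)) u := by
      intro u
      apply HasDerivAt.fun_sum
      intro j _
      have h1 : HasDerivAt (fun u : ℝ => (α j - α s) * u) (α j - α s) u := by
        simpa using (hasDerivAt_id u).const_mul (α j - α s)
      have h2 := (h1.exp).const_mul (c j)
      have e : c j * (α j - α s) * Real.exp ((α j - α s) * u) =
          c j * (Real.exp ((α j - α s) * u) * (α j - α s)) := by ring
      rw [e]
      exact h2
    have hmvt : ∀ p : Fin (k + 1), ∃ z, y p.castSucc < z ∧ z < y p.succ ∧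
        0 ≤ (-1 : ℝ) ^ (p : ℕ) * -(∑ j, (c j * (α j - α s)) * Real.exp ((α j - α s) * z)) := by
      intro p
      have hyp : y p.castSucc < y p.succ := hy (Fin.castSucc_lt_succ)
      obtain ⟨z, hz, hz'⟩ := exists_hasDerivAt_eq_slope g _ hyp
        (fun u _ => (hder u).continuousAt.continuousWithinAt) (fun u _ => hder u)
      refine ⟨z, hz.1, hz.2, ?_⟩
      rw [hz']
      have h1 := hgalt p.castSucc
      have h2 := hgalt p.succ
      simp only [Fin.val_castSucc, Fin.val_succ, pow_succ] at h1 h2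
      rw [← neg_div, ← mul_div_assoc]
      apply div_nonneg _ (by linarith)
      linarith
    choose z hz1 hz2 hz3 using hmvt
    have hzmono : StrictMono z := by
      intro p q hpq
      calc z p < y p.succ := hz2 p
        _ ≤ y q.castSucc := hy.monotone (by rw [Fin.le_def]; simpa using hpq)
        _ < z q := hz1 q
    set c' : ι → ℝ := fun j => -(c j * (α j - α s)) with hc'
    by_cases hz : c' = 0
    · exfalso
      have hsup : ∀ j, j ≠ s → c j = 0 := by
        intro j hj
        have := congrFun hz j
        simp only [hc', Pi.zero_apply, neg_eq_zero, mul_eq_zero] at this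
        rcases this with h | h
        · exact h
        · exact absurd (hα.injective (sub_eq_zero.mp h)) hj
      have h1 := h 1
      rw [Finset.sum_eq_single s (fun j _ hj => by rw [hsup j hj, zero_mul]) (by simp)] at h1
      have := mul_pos hcs (Real.exp_pos (α s * y 1))
      simp at h1
      linarith
    · have key := ih c' hz z hzmono (fun p => by
        have h3 := hz3 p
        have : ∑ j, c' j * Real.exp (α j * z p) = Real.exp (α s * z p) *
            -(∑ j, (c j * (α j - α s)) * Real.exp ((α j - α s) * z p)) := by
          rw [← Finset.sum_neg_distrib, Finset.mul_sum]
          refine Finset.sum_congr rfl fun j _ => ?_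
          have : α j * z p = α s * z p + (α j - α s) * z p := by ring
          rw [this, Real.exp_add, hc']
          ring
        rw [this, mul_left_comm]
        exact mul_nonneg (Real.exp_pos _).le h3)
      obtain ⟨j, hj, hjc⟩ := key
      have hs0 : s < j 0 := by
        by_contra hcon
        push Not at hcon
        have h0 := hjc 0
        simp only [hc', Fin.val_zero, pow_zero, one_mul] at h0
        rcases hcon.lt_or_eq with h | h
        · have := hlt _ h
          have h4 := hα h
          nlinarith
        · rw [h] at h0
          simp at h0
      refine SAlt_cons c s j hj hs0 hcs (fun p => ?_)
      have h0 := hjc p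
      have hp : α s < α (j p) := hα (hs0.trans_le (hj.monotone (Fin.zero_le p)))
      have : (-1 : ℝ) ^ (p : ℕ) * c' (j p) = ((-1 : ℝ) ^ (p : ℕ) * (-c (j p))) * (α (j p) - α s) := by
        rw [hc']; ring
      rw [this] at h0
      exact pos_of_mul_pos_left h0 (by linarith)

theorem real_case {ι : Type*} [LinearOrder ι] [Fintype ι] (M : ι → ι → ℝ)
    (hM : ∀ (k : ℕ) (x : ι → ℝ), x ≠ 0 → WAlt k (fun i => ∑ j, M i j * x j) → SAlt k x)
    (x : ι → ℝ) (hx : x ≠ 0) (r : ℝ) (h : ∀ i, ∑ j, M i j * x j = r * x i) : 0 < r := by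
  by_contra hr
  push Not at hr
  have flip : ∀ (k : ℕ) (x : ι → ℝ), x ≠ 0 → (∀ i, ∑ j, M i j * x j = r * x i) →
      SAlt k (-x) → SAlt k x := by
    intro k x hx h hs
    apply hM k x hx
    obtain ⟨j, hj, hjx⟩ := hs
    refine ⟨j, hj, fun p => ?_⟩
    have := hjx p
    simp only [h, Pi.neg_apply] at this ⊢
    nlinarith
  have hneg : ∀ i, ∑ j, M i j * (-x) j = r * (-x) i := by
    intro i
    simp [h]
  have key : ∀ k, SAlt k x ∨ SAlt k (-x) := by
    intro k
    induction k with
    | zero =>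
      obtain ⟨i, hi⟩ := Function.ne_iff.mp hx
      rcases lt_or_gt_of_ne hi with h | h
      · right
        exact ⟨fun _ => i, strictMono_const_aux _, fun p => by simpa using h⟩
      · left
        exact ⟨fun _ => i, strictMono_const_aux _, fun p => by simpa using h⟩
    | succ k ih =>
      have h1 : SAlt k (-x) → SAlt k x := flip k x hx h
      have h2 : SAlt k x → SAlt k (-x) := fun hh =>
        flip k (-x) (by simpa using hx) hneg (by simpa using hh)
      rcases ih with ih | ih
      · exact SAlt_merge ih (h2 ih)
      · exact SAlt_merge (h1 ih) ih
  rcases key (Fintype.card ι) with h | h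
  · exact not_SAlt_card h
  · exact not_SAlt_card h

theorem unit_recur (η : ℂ) (hη : ‖η‖ = 1) (w : ℂ) (O : Set ℂ) (hO : IsOpen O) (hw : η⁻¹ * w ∈ O) :
    ∃ m : ℕ, η ^ m * w ∈ O := by
  have hη0 : η ≠ 0 := by rintro rfl; simp at hη
  obtain ⟨b, -, φ, hφ, hlim⟩ := (isCompact_closedBall (0 : ℂ) 1).tendsto_subseq
    (x := fun n : ℕ => η ^ n) (fun n => by simp [hη])
  have hb : b ≠ 0 := by
    rintro rfl
    have := hlim.norm
    simp [hη] at this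
  have h2 : Filter.Tendsto (fun n => η ^ (φ (n + 1)) * (η ^ (φ n))⁻¹ * (η⁻¹ * w)) Filter.atTop
      (nhds (b * b⁻¹ * (η⁻¹ * w))) :=
    (((hlim.comp (Filter.tendsto_add_atTop_nat 1)).mul (hlim.inv₀ hb)).mul_const _)
  rw [mul_inv_cancel₀ hb, one_mul] at h2
  obtain ⟨n, hn⟩ := (h2.eventually (hO.mem_nhds hw)).exists
  have hlt : φ n < φ (n + 1) := hφ (Nat.lt_succ_self n)
  obtain ⟨d, hd⟩ := Nat.exists_eq_add_of_lt hlt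
  refine ⟨d, ?_⟩
  have e : η ^ (φ (n + 1)) * (η ^ (φ n))⁻¹ * (η⁻¹ * w) = η ^ d * w := by
    rw [hd, pow_succ, pow_add]
    have := pow_ne_zero (φ n) hη0
    field_simp
  rw [← e]
  exact hn

theorem complex_case {ι : Type*} [LinearOrder ι] [Fintype ι] (M : ι → ι → ℝ)
    (hM : ∀ (k : ℕ) (x : ι → ℝ), x ≠ 0 → WAlt k (fun i => ∑ j, M i j * x j) → SAlt k x)
    (v : ι → ℂ) (hv : v ≠ 0) (μ : ℂ) (h : ∀ i, ∑ j, (M i j : ℂ) * v j = μ * v i) :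
    μ.im = 0 ∧ 0 < μ.re := by
  have hre : ∀ z : ℂ, ∀ i, ∑ j, M i j * (z * v j).re = (μ * z * v i).re := by
    intro z i
    have : μ * z * v i = ∑ j, (M i j : ℂ) * (z * v j) := by
      rw [mul_comm μ z, mul_assoc, ← h, Finset.mul_sum]
      exact Finset.sum_congr rfl fun j _ => by ring
    rw [this, Complex.re_sum]
    exact Finset.sum_congr rfl fun j _ => by rw [Complex.re_ofReal_mul]
  by_cases him : μ.im = 0
  · refine ⟨him, ?_⟩
    obtain ⟨i, hi⟩ := Function.ne_iff.mp hv
    have hμ : μ = (μ.re : ℂ) := by apply Complex.ext <;> simp [him]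
    obtain ⟨z, hz⟩ : ∃ z : ℂ, (z * v i).re ≠ 0 := by
      refine ⟨(starRingEnd ℂ) (v i), ?_⟩
      rw [← Complex.normSq_eq_conj_mul_self, Complex.ofReal_re]
      simpa using hi
    refine real_case M hM (fun i => (z * v i).re) (fun h0 => hz (congrFun h0 i)) μ.re
      (fun i => ?_)
    rw [hre, mul_assoc]
    conv_lhs => rw [hμ]
    rw [Complex.re_ofReal_mul]
  · exfalso
    have hμ0 : μ ≠ 0 := by rintro rfl; simp at him
    have hU0 : ∀ z : ℂ, z ≠ 0 → (fun i => (z * v i).re) ≠ 0 := by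
      intro z hz h0
      obtain ⟨i, hi⟩ := Function.ne_iff.mp hv
      have h1 : ∀ i, (z * v i).re = 0 := fun i => congrFun h0 i
      have h2 := hre z i
      simp only [h1, mul_zero, Finset.sum_const_zero] at h2
      rw [mul_assoc, Complex.mul_re, h1] at h2
      have h3 : (z * v i).im = 0 := by
        have : μ.im * (z * v i).im = 0 := by linarith
        exact (mul_eq_zero.mp this).resolve_left him
      exact mul_ne_zero hz hi (Complex.ext (h1 i) h3)
    set η : ℂ := μ / ‖μ‖ with hη
    have hnpos : 0 < ‖μ‖ := norm_pos_iff.mpr hμ0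
    have hηn : ‖η‖ = 1 := by simp [hη, hμ0]
    have hη0 : η ≠ 0 := by rintro h0; simp [h0] at hηn
    have hμη : μ = (‖μ‖ : ℂ) * η := by
      rw [hη, mul_div_cancel₀]
      exact_mod_cast hnpos.ne'
    have step : ∀ (k : ℕ) (z : ℂ), z ≠ 0 → WAlt k (fun i => (η * z * v i).re) →
        SAlt k (fun i => (z * v i).re) := by
      rintro k z hz ⟨j, hj, hjx⟩
      refine hM k _ (hU0 z hz) ⟨j, hj, fun p => ?_⟩
      have h1 := hjx p
      have : (μ * z * v (j p)).re = ‖μ‖ * (η * z * v (j p)).re := by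
        conv_lhs => rw [hμη]
        rw [mul_assoc, mul_assoc, Complex.re_ofReal_mul, ← mul_assoc]
      simp only [hre, this]
      rw [mul_left_comm]
      exact mul_nonneg hnpos.le h1
    have steps : ∀ (k m : ℕ) (z : ℂ), z ≠ 0 → SAlt k (fun i => (η ^ m * z * v i).re) →
        SAlt k (fun i => (z * v i).re) := by
      intro k m
      induction m with
      | zero => intro z hz hs; simpa using hs
      | succ m ih =>
        intro z hz hs
        apply ih z hz
        apply step k _ (mul_ne_zero (pow_ne_zero _ hη0) hz)
        have := hs.weak
        convert this using 4
        ring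
    have hne : Nonempty ι := by
      obtain ⟨i, hi⟩ := Function.ne_iff.mp hv
      exact ⟨i⟩
    obtain ⟨i0, hi0⟩ := Finite.exists_min (id : ι → ι)
    have key : ∀ k, ∃ z : ℂ, z ≠ 0 ∧ (z * v i0).re = 0 ∧ SAlt k (fun i => (z * v i).re) := by
      intro k
      induction k with
      | zero =>
        obtain ⟨z, hz, hz0⟩ : ∃ z : ℂ, z ≠ 0 ∧ (z * v i0).re = 0 := by
          by_cases h0 : v i0 = 0
          · exact ⟨1, one_ne_zero, by simp [h0]⟩
          · refine ⟨Complex.I / v i0, div_ne_zero Complex.I_ne_zero h0, ?_⟩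
            rw [div_mul_cancel₀ _ h0]; simp
        obtain ⟨i, hi⟩ := Function.ne_iff.mp (hU0 z hz)
        rcases lt_or_gt_of_ne hi with h | h
        · refine ⟨-z, neg_ne_zero.mpr hz, by rw [neg_mul, Complex.neg_re, hz0, neg_zero], fun _ => i,
            strictMono_const_aux _, fun p => ?_⟩
          simp only [Pi.zero_apply] at h
          simp only [neg_mul, Complex.neg_re, Fin.val_eq_zero, pow_zero, one_mul]
          linarith
        · refine ⟨z, hz, hz0, fun _ => i, strictMono_const_aux _, fun p => ?_⟩
          simp only [Pi.zero_apply] at h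
          simp only [Fin.val_eq_zero, pow_zero, one_mul]
          linarith
      | succ k ih =>
        obtain ⟨z, hz, hz0, j, hj, hjx⟩ := ih
        refine ⟨-z, neg_ne_zero.mpr hz, by rw [neg_mul, Complex.neg_re, hz0, neg_zero], ?_⟩
        have hlt : i0 < j 0 := by
          refine lt_of_le_of_ne (hi0 _) ?_
          rintro h
          have := hjx 0
          rw [← h] at this
          simp only [hz0, mul_zero, lt_irrefl] at this
        have hw : WAlt (k + 1) (fun i => (-z * v i).re) := by
          refine WAlt_cons _ i0 j hj hlt ?_ (fun p => ?_)
          · simp only [neg_mul, Complex.neg_re, hz0, neg_zero, le_refl]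
          · simpa only [neg_mul, Complex.neg_re, neg_neg] using hjx p
        have hnz : -z ≠ 0 := neg_ne_zero.mpr hz
        have hs : SAlt (k + 1) (fun i => (η⁻¹ * (-z) * v i).re) := by
          apply step _ _ (mul_ne_zero (inv_ne_zero hη0) hnz)
          rw [mul_inv_cancel_left₀ hη0]
          exact hw
        obtain ⟨q, hq, hqx⟩ := hs
        have hopen : IsOpen {u : ℂ | ∀ p : Fin (k + 1 + 1),
            0 < (-1 : ℝ) ^ (p : ℕ) * (u * v (q p)).re} := by
          simp only [Set.ofPred_forall]
          refine isOpen_iInter_of_finite fun p => ?_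
          refine isOpen_lt continuous_const ?_
          exact continuous_const.mul (Complex.continuous_re.comp
            (continuous_id.mul continuous_const))
        obtain ⟨m, hm⟩ := unit_recur η hηn (-z) _ hopen hqx
        exact steps (k + 1) m (-z) hnz ⟨q, hq, hm⟩
    obtain ⟨z, -, -, hs⟩ := key (Fintype.card ι)
    exact not_SAlt_card hs

theorem exp_matrix_eig {ι : Type*} [LinearOrder ι] [Fintype ι] (M : ι → ι → ℝ)
    (α y d w : ι → ℝ) (hα : StrictMono α) (hy : StrictMono y) (hd : ∀ i, 0 < d i)
    (hw : ∀ i, 0 < w i) (hM : ∀ i j, M i j = d i * w j * Real.exp (α j * y i))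
    (v : ι → ℂ) (hv : v ≠ 0) (μ : ℂ) (h : ∀ i, ∑ j, (M i j : ℂ) * v j = μ * v i) :
    μ.im = 0 ∧ 0 < μ.re := by
  refine complex_case M ?_ v hv μ h
  rintro k x hx ⟨j, hj, hjx⟩
  have := exp_vd α hα k (fun i => w i * x i) ?_ (fun p => y (j p)) (hy.comp hj) ?_
  · obtain ⟨q, hq, hqx⟩ := this
    refine ⟨q, hq, fun p => ?_⟩
    have h1 := hqx p
    rw [mul_left_comm] at h1
    exact pos_of_mul_pos_right h1 (hw _).le
  · obtain ⟨i, hi⟩ := Function.ne_iff.mp hx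
    exact Function.ne_iff.mpr ⟨i, mul_ne_zero (hw i).ne' hi⟩
  · intro p
    have h1 := hjx p
    have : ∑ i, M (j p) i * x i = d (j p) * ∑ i, w i * x i * Real.exp (α i * y (j p)) := by
      rw [Finset.mul_sum]
      exact Finset.sum_congr rfl fun i _ => by rw [hM]; ring
    simp only [this] at h1
    rw [mul_left_comm] at h1
    exact nonneg_of_mul_nonneg_right h1 (hd _)

theorem stoch_norm_le {ι : Type*} [Fintype ι] (M : ι → ι → ℝ) (hM : ∀ i j, 0 ≤ M i j)
    (hs : ∀ i, ∑ j, M i j = 1)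
    (v : ι → ℂ) (hv : v ≠ 0) (μ : ℂ) (h : ∀ i, ∑ j, (M i j : ℂ) * v j = μ * v i) :
    ‖μ‖ ≤ 1 := by
  obtain ⟨i1, hi1⟩ := Function.ne_iff.mp hv
  have : Nonempty ι := ⟨i1⟩
  obtain ⟨i, hi⟩ := Finite.exists_max (fun i => ‖v i‖)
  have hpos : 0 < ‖v i‖ := (norm_pos_iff.mpr hi1).trans_le (hi i1)
  have : ‖μ‖ * ‖v i‖ ≤ 1 * ‖v i‖ := by
    rw [← norm_mul, ← h, ← hs i, Finset.sum_mul]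
    refine (norm_sum_le _ _).trans (Finset.sum_le_sum fun j _ => ?_)
    rw [norm_mul, Complex.norm_real, Real.norm_of_nonneg (hM i j)]
    exact mul_le_mul_of_nonneg_left (hi j) (hM i j)
  exact le_of_mul_le_mul_right this hpos

/-- The GT-Bernstein basis functions
`β_{a_i}(t) = c_{a_i} (l(t − a_0))^{l(a_i − a_0)} (l(a_n − t))^{l(a_n − a_i)}`,
where powers are real powers (`Real.rpow`, which satisfies `0 ^ 0 = 1`). -/
noncomputable def gtBernstein (n : ℕ) (a c : Fin (n + 1) → ℝ) (l : ℝ)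
    (i : Fin (n + 1)) (t : ℝ) : ℝ :=
  c i * (l * (t - a 0)) ^ (l * (a i - a 0)) *
    (l * (a (Fin.last n) - t)) ^ (l * (a (Fin.last n) - a i))

/-- The rational GT-Bernstein basis functions
`𝒯_{a_i}(t) = ω_{a_i} β_{a_i}(t) / Σ_j ω_{a_j} β_{a_j}(t)`. -/
noncomputable def ratGTBernstein (n : ℕ) (a c : Fin (n + 1) → ℝ) (l : ℝ)
    (ω : Fin (n + 1) → ℝ) (i : Fin (n + 1)) (t : ℝ) : ℝ :=
  ω i * gtBernstein n a c l i t / ∑ j, ω j * gtBernstein n a c l j t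

/-- For strictly increasing nodes `a 0 < a 1 < ⋯ < a n`, coefficients
`c i > 0`, `l > 0`, weights `ω i > 0`, and parameters
`a 0 ≤ t 0 < t 1 < ⋯ < t n ≤ a n`, every complex eigenvalue `μ` of the collocation
matrix `M = [𝒯_{a_j}(t_i)]` (i.e. every root of the characteristic polynomial of `M`
viewed as a complex matrix) is real and satisfies `0 < μ ≤ 1`. -/
theorem ratGTBernstein_collocation_eigenvalues
    (n : ℕ) (a c : Fin (n + 1) → ℝ) (l : ℝ) (ω : Fin (n + 1) → ℝ)
    (ha : StrictMono a) (hc : ∀ i, 0 < c i) (hl : 0 < l) (hω : ∀ i, 0 < ω i)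
    (t : Fin (n + 1) → ℝ) (ht : StrictMono t)
    (ht0 : a 0 ≤ t 0) (htn : t (Fin.last n) ≤ a (Fin.last n))
    (μ : ℂ)
    (hμ : (Matrix.charpoly ((Matrix.of fun i j : Fin (n + 1) =>
        ratGTBernstein n a c l ω j (t i)).map Complex.ofReal)).IsRoot μ) :
    μ.im = 0 ∧ 0 < μ.re ∧ μ.re ≤ 1 := by
  classical
  set M : Fin (n + 1) → Fin (n + 1) → ℝ := fun i j => ratGTBernstein n a c l ω j (t i) with hMdef
  -- eigenvector
  obtain ⟨v, hv, hev⟩ : ∃ v : Fin (n + 1) → ℂ, v ≠ 0 ∧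
      ∀ i, ∑ j, (M i j : ℂ) * v j = μ * v i := by
    rw [Polynomial.IsRoot, Matrix.eval_charpoly] at hμ
    obtain ⟨v, hv, h⟩ := Matrix.exists_mulVec_eq_zero_iff.mpr hμ
    refine ⟨v, hv, fun i => ?_⟩
    have hi := congrFun h i
    rw [Matrix.sub_mulVec] at hi
    simp only [Pi.sub_apply, Pi.zero_apply, Matrix.scalar_apply, Matrix.mulVec_diagonal] at hi
    rw [sub_eq_zero] at hi
    rw [hi]
    rfl
  have htl : ∀ i, a 0 ≤ t i := fun i => ht0.trans (ht.monotone (Fin.zero_le i))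
  have htu : ∀ i, t i ≤ a (Fin.last n) := fun i => (ht.monotone (Fin.le_last i)).trans htn
  have hβ : ∀ i j, 0 ≤ gtBernstein n a c l j (t i) := by
    intro i j
    unfold gtBernstein
    have h1 := htl i
    have h2 := htu i
    exact mul_nonneg (mul_nonneg (hc j).le (Real.rpow_nonneg (mul_nonneg hl.le (by linarith)) _))
      (Real.rpow_nonneg (mul_nonneg hl.le (by linarith)) _)
  have hD : ∀ i, 0 < ∑ j, ω j * gtBernstein n a c l j (t i) := by
    intro i
    have key : ∃ j, 0 < gtBernstein n a c l j (t i) := by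
      rcases (htl i).eq_or_lt with h | h
      · refine ⟨0, ?_⟩
        rcases (htu i).eq_or_lt with h' | h'
        · simp only [gtBernstein, ← h, ← h', sub_self, mul_zero, Real.rpow_zero, mul_one]
          exact hc 0
        · simp only [gtBernstein, sub_self, mul_zero, Real.rpow_zero, mul_one]
          exact mul_pos (hc 0) (Real.rpow_pos_of_pos (mul_pos hl (by linarith)) _)
      · refine ⟨Fin.last n, ?_⟩
        simp only [gtBernstein, sub_self, mul_zero, Real.rpow_zero, mul_one]
        exact mul_pos (hc _) (Real.rpow_pos_of_pos (mul_pos hl (by linarith)) _)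
    obtain ⟨j, hj⟩ := key
    exact Finset.sum_pos' (fun j _ => mul_nonneg (hω j).le (hβ i j))
      ⟨j, Finset.mem_univ _, mul_pos (hω j) hj⟩
  have hM0 : ∀ i j, 0 ≤ M i j := fun i j =>
    div_nonneg (mul_nonneg (hω j).le (hβ i j)) (hD i).le
  have hM1 : ∀ i, ∑ j, M i j = 1 := by
    intro i
    simp only [hMdef, ratGTBernstein]
    rw [← Finset.sum_div]
    exact div_self (hD i).ne'
  have hnorm := stoch_norm_le M hM0 hM1 v hv μ hev
  suffices hmain : μ.im = 0 ∧ 0 < μ.re from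
    ⟨hmain.1, hmain.2, (Complex.re_le_norm μ).trans hnorm⟩
  by_cases hμ1 : μ = 1
  · subst hμ1; simp
  -- unit rows force zero entries
  have hrow : ∀ i, (∀ j, j ≠ i → gtBernstein n a c l j (t i) = 0) → v i = 0 := by
    intro i hi
    have hz : ∀ j, j ≠ i → M i j = 0 := by
      intro j hj
      simp [hMdef, ratGTBernstein, hi j hj]
    have h1 := hM1 i
    rw [Finset.sum_eq_single i (fun j _ hj => hz j hj) (by simp)] at h1
    have h2 := hev i
    rw [Finset.sum_eq_single i (fun j _ hj => by rw [hz j hj]; simp) (by simp), h1] at h2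
    have h3 : (μ - 1) * v i = 0 := by
      rw [sub_mul, ← h2]; simp
    exact (mul_eq_zero.mp h3).resolve_left (sub_ne_zero.mpr hμ1)
  have hoff : ∀ i, ¬ (a 0 < t i ∧ t i < a (Fin.last n)) → v i = 0 := by
    intro i hi
    apply hrow
    intro j hj
    by_cases h0 : a 0 < t i
    · have hi' : t i = a (Fin.last n) := le_antisymm (htu i) (not_lt.mp fun h => hi ⟨h0, h⟩)
      have hil : i = Fin.last n := by
        apply ht.injective
        exact le_antisymm (ht.monotone (Fin.le_last i)) (by rw [hi']; exact htn)
      have hjl : a j < a (Fin.last n) := ha (lt_of_le_of_ne (Fin.le_last j) (hil ▸ hj))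
      have : l * (a (Fin.last n) - a j) ≠ 0 := (mul_pos hl (by linarith)).ne'
      simp only [gtBernstein, hi', sub_self, mul_zero, Real.zero_rpow this]
    · have hi' : t i = a 0 := le_antisymm (not_lt.mp h0) (htl i)
      have hil : i = 0 := by
        apply ht.injective
        exact le_antisymm (by rw [hi']; exact ht0) (ht.monotone (Fin.zero_le i))
      have hjl : a 0 < a j := ha (lt_of_le_of_ne (Fin.zero_le j) (hil ▸ hj).symm)
      have : l * (a j - a 0) ≠ 0 := (mul_pos hl (by linarith)).ne'
      simp only [gtBernstein, hi', sub_self, mul_zero, Real.zero_rpow this, zero_mul]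
  let S := {i : Fin (n + 1) // a 0 < t i ∧ t i < a (Fin.last n)}
  have hX : ∀ i : S, 0 < l * (t i - a 0) := fun i => mul_pos hl (by linarith [i.2.1])
  have hY : ∀ i : S, 0 < l * (a (Fin.last n) - t i) := fun i => mul_pos hl (by linarith [i.2.2])
  refine exp_matrix_eig (ι := S) (fun i j => M i j) (fun j => l * a j)
    (fun i => Real.log (l * (t i - a 0)) - Real.log (l * (a (Fin.last n) - t i)))
    (fun i => Real.exp (l * (Real.log (l * (a (Fin.last n) - t i)) * a (Fin.last n)
      - Real.log (l * (t i - a 0)) * a 0)) / ∑ j, ω j * gtBernstein n a c l j (t i))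
    (fun j => ω j * c j) ?_ ?_ ?_ ?_ ?_ (fun i => v i) ?_ μ ?_
  · intro i j hij
    exact mul_lt_mul_of_pos_left (ha hij) hl
  · intro i j hij
    have htij : t i < t j := ht hij
    have h1 := Real.log_lt_log (hX i) (mul_lt_mul_of_pos_left (sub_lt_sub_right htij (a 0)) hl)
    have h2 := Real.log_lt_log (hY j)
      (mul_lt_mul_of_pos_left (sub_lt_sub_left htij (a (Fin.last n))) hl)
    exact sub_lt_sub h1 h2
  · intro i
    exact div_pos (Real.exp_pos _) (hD i)
  · intro i
    exact mul_pos (hω i) (hc i)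
  · intro i j
    simp only [hMdef, ratGTBernstein]
    rw [div_mul_eq_mul_div, div_mul_eq_mul_div]
    congr 1
    rw [gtBernstein, Real.rpow_def_of_pos (hX i), Real.rpow_def_of_pos (hY i)]
    have e : ∀ A B C D p q : ℝ, C + D = A + B →
        p * (q * Real.exp C * Real.exp D) = Real.exp A * (p * q) * Real.exp B := by
      intro A B C D p q hE
      have := congrArg Real.exp hE
      rw [Real.exp_add, Real.exp_add] at this
      linear_combination p * q * this
    apply e
    ring
  · intro h0
    apply hv
    funext i
    by_cases hi : a 0 < t i ∧ t i < a (Fin.last n)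
    · exact congrFun h0 ⟨i, hi⟩
    · exact hoff i hi
  · intro i
    rw [← hev i]
    have e := Finset.sum_subtype (F := inferInstance)
      (Finset.univ.filter fun j => a 0 < t j ∧ t j < a (Fin.last n))
      (p := fun j => a 0 < t j ∧ t j < a (Fin.last n)) (by simp)
      (fun j => (M i j : ℂ) * v j)
    refine e.symm.trans (Finset.sum_subset (Finset.subset_univ _) fun j _ hj => ?_)
    rw [hoff j (by simpa using hj), mul_zero]
end

section
/- Let a_0 < a_1 < ⋯ < a_n be real numbers, let c_{a_0}, …, c_{a_n} > 0, l > 0, and weights ω_{a_0}, …, ω_{a_n} > 0, let 𝒯_{a_i} be the rational GT-Bernstein basis functions, let a_0 ≤ t_0 < t_1 < ⋯ < t_n ≤ a_n, and let M = [𝒯_{a_j}(t_i)]_{i,j=0}^{n} be the collocation matrix. Given points P_0, …, P_n in ℝ^d, define the progressive iterative approximation sequence of control points by P_i^0 = P_i and P_i^{k+1} = P_i^k + (P_i − Σ_{j=0}^{n} M_{ij} P_j^k) for k = 0, 1, 2, …. Then the GT-Bézier curve has the progressive iterative approximation property: for every i = 0, 1, …, n, the value of the k-th iterated curve at t_i converges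 to P_i, i.e., lim_{k→∞} Σ_{j=0}^{n} M_{ij} P_j^k = P_i. Equivalently, the matrix powers (I − M)^k converge to the zero matrix as k → ∞. -/
open Filter Topology

open Filter Topology
/-- Strictly alternating chain of length `k+1` starting at `i` with a positive value. -/
def SChain {α : Type*} [LinearOrder α] : (α → ℝ) → ℕ → α → Prop
  | x, 0, i => 0 < x i
  | x, k + 1, i => 0 < x i ∧ ∃ j, i < j ∧ SChain (-x) k j

/-- Weakly alternating chain of length `k+1` starting at `i` with a nonnegative value. -/
def WChain {α : Type*} [LinearOrder α] : (α → ℝ) → ℕ → α → Prop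
  | x, 0, i => 0 ≤ x i
  | x, k + 1, i => 0 ≤ x i ∧ ∃ j, i < j ∧ WChain (-x) k j

section
variable {α β : Type*} [LinearOrder α] [LinearOrder β]

theorem SChain.pos {x : α → ℝ} {k : ℕ} {i : α} (h : SChain x k i) : 0 < x i := by
  cases k with
  | zero => exact h
  | succ k => exact h.1

theorem WChain.nonneg {x : α → ℝ} {k : ℕ} {i : α} (h : WChain x k i) : 0 ≤ x i := by
  cases k with
  | zero => exact h
  | succ k => exact h.1

theorem SChain.congr {k : ℕ} : ∀ {x y : α → ℝ} {i : α}, SChain x k i →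
    (∀ j, i ≤ j → 0 < x j → 0 < y j) → (∀ j, i ≤ j → x j < 0 → y j < 0) → SChain y k i := by
  induction k with
  | zero => intro x y i h h1 _; exact h1 i le_rfl h
  | succ k ih =>
    intro x y i h h1 h2
    obtain ⟨h0, j, hij, hj⟩ := h
    refine ⟨h1 i le_rfl h0, j, hij, ih hj ?_ ?_⟩
    · intro m hm hx
      have := h2 m (hij.le.trans hm) (by simpa using hx)
      simpa using this
    · intro m hm hx
      have := h1 m (hij.le.trans hm) (by simpa using hx)
      simpa using this

theorem SChain.weak {k : ℕ} : ∀ {x y : α → ℝ} {i : α}, SChain x k i →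
    (∀ j, 0 < x j → 0 ≤ y j) → (∀ j, x j < 0 → y j ≤ 0) → WChain y k i := by
  induction k with
  | zero => intro x y i h h1 _; exact h1 i h
  | succ k ih =>
    intro x y i h h1 h2
    obtain ⟨h0, j, hij, hj⟩ := h
    refine ⟨h1 i h0, j, hij, ih hj ?_ ?_⟩
    · intro m hx
      have := h2 m (by simpa using hx)
      simpa using this
    · intro m hx
      have := h1 m (by simpa using hx)
      simpa using this

theorem WChain.map {k : ℕ} {u : α → β} (hu : StrictMono u) : ∀ {x : α → ℝ} {f : β → ℝ} {i : α},
    WChain x k i → (∀ j, 0 ≤ x j → 0 ≤ f (u j)) → (∀ j, x j ≤ 0 → f (u j) ≤ 0) →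
    WChain f k (u i) := by
  induction k with
  | zero => intro x f i h h1 _; exact h1 i h
  | succ k ih =>
    intro x y i h h1 h2
    obtain ⟨h0, j, hij, hj⟩ := h
    refine ⟨h1 i h0, u j, hu hij, ih hj ?_ ?_⟩
    · intro m hx
      have := h2 m (by simpa using hx)
      simpa using this
    · intro m hx
      have := h1 m (by simpa using hx)
      simpa using this

theorem SChain.bound [Fintype α] {k : ℕ} : ∀ {x : α → ℝ} {i : α}, SChain x k i →
    k < (Finset.univ.filter (fun j => i ≤ j)).card := by
  induction k with
  | zero => intro x i _; exact Finset.card_pos.2 ⟨i, by simp⟩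
  | succ k ih =>
    intro x i h
    obtain ⟨h0, j, hij, hj⟩ := h
    have h1 := ih hj
    have h2 : (Finset.univ.filter (fun m => j ≤ m)).card <
        (Finset.univ.filter (fun m => i ≤ m)).card := by
      apply Finset.card_lt_card
      refine (Finset.ssubset_iff_of_subset ?_).2 ⟨i, by simp, by simpa using hij⟩
      intro m hm
      simp only [Finset.mem_filter, Finset.mem_univ, true_and] at hm ⊢
      exact hij.le.trans hm
    omega

theorem SChain.lt_card [Fintype α] {k : ℕ} {x : α → ℝ} {i : α} (h : SChain x k i) :
    k < Fintype.card α :=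
  h.bound.trans_le (Finset.card_le_univ _)

theorem SChain.isOpen (k : ℕ) : ∀ i : α, IsOpen {x : α → ℝ | SChain x k i} := by
  induction k with
  | zero => intro i; exact isOpen_lt continuous_const (continuous_apply i)
  | succ k ih =>
    intro i
    have : {x : α → ℝ | SChain x (k+1) i} =
      {x | 0 < x i} ∩ ⋃ j, ⋃ (_ : i < j), (fun x => -x) ⁻¹' {x | SChain x k j} := by
      ext x
      simp [SChain]
    rw [this]
    exact (isOpen_lt continuous_const (continuous_apply i)).inter
      (isOpen_iUnion fun j => isOpen_iUnion fun _ => (ih j).preimage continuous_neg)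

theorem WChain.rolle {k : ℕ} : ∀ {g g' : ℝ → ℝ} {u : ℝ}, (∀ s, HasDerivAt g (g' s) s) →
    WChain g (k+1) u → ∃ v, u < v ∧ WChain (-g') k v := by
  induction k with
  | zero =>
    intro g g' u hg h
    obtain ⟨h0, j, hij, hj⟩ := h
    obtain ⟨c, hc, h⟩ := exists_hasDerivAt_eq_slope g g' hij
      (fun s _ => (hg s).continuousAt.continuousWithinAt) (fun s _ => hg s)
    refine ⟨c, hc.1, ?_⟩
    have hj : 0 ≤ - g j := hj
    change 0 ≤ - g' c
    rw [h, ← neg_div]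
    exact div_nonneg (by linarith) (by linarith)
  | succ k ih =>
    intro g g' u hg h
    obtain ⟨h0, j, hij, hj'⟩ := h
    obtain ⟨c, hc, h⟩ := exists_hasDerivAt_eq_slope g g' hij
      (fun s _ => (hg s).continuousAt.continuousWithinAt) (fun s _ => hg s)
    have hj : 0 ≤ - g j := hj'.nonneg
    obtain ⟨v, hv, hv'⟩ := ih (g := -g) (g' := -g') (fun s => (hg s).neg) hj'
    refine ⟨c, hc.1, ?_, v, hc.2.trans hv, hv'⟩
    change 0 ≤ - g' c
    rw [h, ← neg_div]
    exact div_nonneg (by linarith) (by linarith)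

theorem exists_cut [Fintype α] (b : α → ℝ) (hb : StrictMono b) (q : α) :
    ∃ c, c < b q ∧ ∀ j, j < q → b j < c := by
  have h1 : ∀ᶠ c in 𝓝[<] (b q), ∀ j, j < q → b j < c := by
    rw [eventually_all]
    intro j
    by_cases hj : j < q
    · have : ∀ᶠ c in 𝓝 (b q), b j < c := eventually_gt_nhds (hb hj)
      filter_upwards [this.filter_mono nhdsWithin_le_nhds] with c hc _ using hc
    · simp [hj]
  obtain ⟨c, hc, hc'⟩ := (h1.and self_mem_nhdsWithin).exists
  exact ⟨c, hc', hc⟩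

/-- The variation diminishing property of exponential sums. -/
theorem vd_exp [Fintype α] (b : α → ℝ) (hb : StrictMono b) (k : ℕ) : ∀ (x : α → ℝ), x ≠ 0 → ∀ u : ℝ,
    WChain (fun s => ∑ j, x j * Real.exp (s * b j)) k u → ∃ j, SChain x k j := by
  have first : ∀ (P : α → Prop), (∃ j, P j) → ∃ p, P p ∧ ∀ j, j < p → ¬ P j := by
    classical
    intro P ⟨j, hj⟩
    have hne : (Finset.univ.filter P).Nonempty := ⟨j, by simpa using hj⟩
    refine ⟨(Finset.univ.filter P).min' hne, by simpa using Finset.min'_mem _ hne, ?_⟩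
    intro m hm hPm
    exact absurd (Finset.min'_le _ m (by simpa using hPm)) (not_le.2 hm)
  have base : ∀ (x : α → ℝ), x ≠ 0 → ∀ u : ℝ, 0 ≤ ∑ j, x j * Real.exp (u * b j) →
      ∃ j, 0 < x j := by
    intro x hx u h
    by_contra! hneg
    apply hx
    have h2 := (Finset.sum_eq_zero_iff_of_nonpos (s := Finset.univ)
      (f := fun j => x j * Real.exp (u * b j)) (fun j _ =>
        mul_nonpos_of_nonpos_of_nonneg (hneg j) (Real.exp_pos _).le)).1
      (le_antisymm (Finset.sum_nonpos fun j _ =>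
        mul_nonpos_of_nonpos_of_nonneg (hneg j) (Real.exp_pos _).le) h)
    funext j
    have := h2 j (Finset.mem_univ j)
    simpa [(Real.exp_pos _).ne'] using this
  induction k with
  | zero => intro x hx u h; exact base x hx u h
  | succ k ih =>
    intro x hx u h
    obtain ⟨p, hp, hpmin⟩ := first (fun j => 0 < x j) (base x hx u h.nonneg)
    have step : ∀ c : ℝ, (∀ j, b j ≠ c) → ∃ j, SChain (fun j => -((b j - c) * x j)) k j := by
      intro c hc
      have hg : ∀ s, HasDerivAt (fun s => ∑ j, x j * Real.exp (s * (b j - c)))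
          (∑ j, ((b j - c) * x j) * Real.exp (s * (b j - c))) s := by
        intro s
        apply HasDerivAt.fun_sum
        intro j _
        have := (((hasDerivAt_id s).mul_const (b j - c)).exp).const_mul (x j)
        refine this.congr_deriv ?_
        simp only [id]
        ring
      have hw : WChain (fun s => ∑ j, x j * Real.exp (s * (b j - c))) (k+1) u := by
        have key : ∀ s, (∑ j, x j * Real.exp (s * (b j - c))) =
            (∑ j, x j * Real.exp (s * b j)) * Real.exp (-(s*c)) := by
          intro s
          rw [Finset.sum_mul]
          refine Finset.sum_congr rfl fun j _ => ?_
          rw [mul_assoc, ← Real.exp_add]; ring_nf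
        refine WChain.map (u := fun s : ℝ => s) strictMono_id h ?_ ?_
        · intro s hs
          rw [key]; exact mul_nonneg hs (Real.exp_pos _).le
        · intro s hs
          rw [key]; exact mul_nonpos_of_nonpos_of_nonneg hs (Real.exp_pos _).le
      obtain ⟨v, _, hv⟩ := WChain.rolle hg hw
      refine ih (fun j => -((b j - c) * x j)) ?_ v ?_
      · intro h0
        have := congrFun h0 p
        simp only [Pi.zero_apply, neg_eq_zero, mul_eq_zero, sub_eq_zero] at this
        rcases this with h | h
        · exact hc p h
        · exact hp.ne' h
      · refine WChain.map (u := fun s : ℝ => s) strictMono_id hv ?_ ?_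
        all_goals
          intro s hs
          have key : (∑ j, -((b j - c) * x j) * Real.exp (s * b j)) =
            (-∑ j, ((b j - c) * x j) * Real.exp (s * (b j - c))) * Real.exp (s*c) := by
            rw [← Finset.sum_neg_distrib, Finset.sum_mul]
            refine Finset.sum_congr rfl fun j _ => ?_
            have e : Real.exp (s * b j) = Real.exp (s * (b j - c)) * Real.exp (s * c) := by
              rw [← Real.exp_add]; ring_nf
            rw [e]; ring
          rw [key]
        · exact mul_nonneg hs (Real.exp_pos _).le
        · exact mul_nonpos_of_nonpos_of_nonneg hs (Real.exp_pos _).le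
    have cutne : ∀ (q : α) (c : ℝ), c < b q → (∀ j, j < q → b j < c) → ∀ j, b j ≠ c := by
      intro q c h1 h2 j
      rcases lt_or_ge j q with hj | hj
      · exact (h2 j hj).ne
      · exact (h1.trans_le (hb.monotone hj)).ne'
    by_cases hq : ∃ q, p < q ∧ x q < 0
    · obtain ⟨q, ⟨hpq, hxq⟩, hqmin⟩ := first _ hq
      obtain ⟨c, hc1, hc2⟩ := exists_cut b hb q
      obtain ⟨j, hj⟩ := step c (cutne q c hc1 hc2)
      have hbig : ∀ m, q ≤ m → 0 < b m - c := fun m hm => by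
        have := hb.monotone hm; linarith
      have hsmall : ∀ m, m < q → b m - c < 0 := fun m hm => by
        have := hc2 m hm; linarith
      refine ⟨p, hp, ?_⟩
      rcases le_or_gt q j with hqj | hqj
      · refine ⟨j, hpq.trans_le hqj, hj.congr ?_ ?_⟩
        · intro m hm h
          have := hbig m (hqj.trans hm)
          simp only [Pi.neg_apply]
          by_contra hcon
          nlinarith
        · intro m hm h
          have := hbig m (hqj.trans hm)
          simp only [Pi.neg_apply]
          by_contra hcon
          nlinarith
      · have hxj : 0 < x j := by
          have h1 := hj.pos
          have h2 := hsmall j hqj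
          by_contra hcon
          nlinarith
        have hpj : p ≤ j := by
          by_contra hcon
          exact hpmin j (not_le.1 hcon) hxj
        refine ⟨q, hpq, ?_⟩
        cases k with
        | zero => change 0 < - x q; linarith
        | succ k =>
          obtain ⟨_, j2, hj2, hch⟩ := hj
          have hpos := hch.pos
          simp only [Pi.neg_apply, neg_neg] at hpos
          have hqj2 : q ≤ j2 := by
            by_contra hcon
            have h1 := hsmall j2 (not_le.1 hcon)
            refine hqmin j2 (not_le.1 hcon) ⟨hpj.trans_lt hj2, ?_⟩
            by_contra hcon
            nlinarith
          have hne : q ≠ j2 := by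
            rintro rfl
            have := hbig q le_rfl
            nlinarith
          refine ⟨by change 0 < - x q; linarith, j2, lt_of_le_of_ne hqj2 hne, hch.congr ?_ ?_⟩
          · intro m hm h
            have := hbig m (hqj2.trans hm)
            simp only [Pi.neg_apply, neg_neg] at h ⊢
            by_contra hcon
            nlinarith
          · intro m hm h
            have := hbig m (hqj2.trans hm)
            simp only [Pi.neg_apply, neg_neg] at h ⊢
            by_contra hcon
            nlinarith
    · exfalso
      push Not at hq
      obtain ⟨c, hc1, hc2⟩ := exists_cut b hb p
      obtain ⟨j, hj⟩ := step c (cutne p c hc1 hc2)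
      have h1 := hj.pos
      rcases lt_or_ge j p with hjp | hjp
      · have h2 := hc2 j hjp
        have h3 := hpmin j hjp
        nlinarith
      · have h2 := hb.monotone hjp
        have h3 : 0 ≤ x j := by
          rcases hjp.eq_or_lt with h | h
          · rw [← h]; exact hp.le
          · exact hq j h
        nlinarith
end

section
variable {α : Type*} [LinearOrder α] [Fintype α]

theorem vd_matrix (A : Matrix α α ℝ) (r u b q : α → ℝ) (hr : ∀ i, 0 < r i) (hq : ∀ i, 0 < q i)
    (hu : StrictMono u) (hb : StrictMono b)
    (hA : ∀ i j, A i j = r i * Real.exp (u i * b j) * q j)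
    {k : ℕ} {x : α → ℝ} {i : α} (hx : x ≠ 0) (h : WChain (A.mulVec x) k i) :
    ∃ j, SChain x k j := by
  have key : ∀ i, (A.mulVec x) i = r i * ∑ j, (q j * x j) * Real.exp (u i * b j) := by
    intro i
    simp only [Matrix.mulVec, dotProduct, hA, Finset.mul_sum]
    exact Finset.sum_congr rfl fun j _ => by ring
  have h1 : WChain (fun s => ∑ j, (q j * x j) * Real.exp (s * b j)) k (u i) := by
    refine WChain.map hu h ?_ ?_
    · intro j hj
      rw [key] at hj
      exact nonneg_of_mul_nonneg_right hj (hr j)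
    · intro j hj
      rw [key] at hj
      exact nonpos_of_mul_nonpos_right hj (hr j)
  obtain ⟨j, hj⟩ := vd_exp b hb k (fun j => q j * x j) (by
    intro h0
    apply hx
    funext j
    have := congrFun h0 j
    simpa [(hq j).ne'] using this) _ h1
  refine ⟨j, hj.congr ?_ ?_⟩
  · intro m _ hm
    exact pos_of_mul_pos_right hm (hq m).le
  · intro m _ hm
    exact neg_of_mul_neg_right hm (hq m).le

/-- Variation diminishing for matrices, abstractly. -/
def VD (A : Matrix α α ℝ) : Prop :=
  ∀ (k : ℕ) (x : α → ℝ) (i : α), x ≠ 0 → WChain (A.mulVec x) k i → ∃ j, SChain x k j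

theorem VD.real_pos {A : Matrix α α ℝ} (hA : VD A) {x : α → ℝ} (hx : x ≠ 0) {μ : ℝ}
    (h : A.mulVec x = μ • x) : 0 < μ := by
  by_contra! hμ
  have step : ∀ k, ∃ y : α → ℝ, y ≠ 0 ∧ A.mulVec y = μ • y ∧ ∃ i, SChain y k i := by
    intro k
    induction k with
    | zero =>
      obtain ⟨i, hi⟩ := Function.ne_iff.1 hx
      rcases lt_or_gt_of_ne hi with hi | hi
      · refine ⟨-x, neg_ne_zero.2 hx, by rw [Matrix.mulVec_neg, h, smul_neg], i, ?_⟩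
        change 0 < - x i
        simpa using hi
      · exact ⟨x, hx, h, i, hi⟩
    | succ k ih =>
      obtain ⟨y, hy, hAy, i, hi⟩ := ih
      obtain ⟨j, hj⟩ := hA k (-y) i (neg_ne_zero.2 hy) (by
        rw [Matrix.mulVec_neg, hAy]
        refine hi.weak ?_ ?_
        · intro m hm
          simp only [Pi.neg_apply, Pi.smul_apply, smul_eq_mul]
          nlinarith
        · intro m hm
          simp only [Pi.neg_apply, Pi.smul_apply, smul_eq_mul]
          nlinarith)
      rcases lt_trichotomy i j with hij | hij | hij
      · exact ⟨y, hy, hAy, i, hi.pos, j, hij, hj⟩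
      · subst hij
        have h1 := hi.pos
        have h2 := hj.pos
        simp only [Pi.neg_apply] at h2
        linarith
      · exact ⟨-y, neg_ne_zero.2 hy, by rw [Matrix.mulVec_neg, hAy, smul_neg], j, hj.pos, i, hij,
          by rwa [neg_neg]⟩
  obtain ⟨y, _, _, i, hi⟩ := step (Fintype.card α)
  exact absurd hi.lt_card (lt_irrefl _)

theorem exists_pow_near_one (e : ℂ) (he : ‖e‖ = 1) (U : Set ℂ) (hU : U ∈ 𝓝 (1 : ℂ)) :
    ∃ N : ℕ, e ^ (N + 1) ∈ U := by
  obtain ⟨E, hE⟩ : ∃ E : Circle, (E : ℂ) = e :=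
    ⟨⟨e, by simpa [Submonoid.unitSphere] using he⟩, rfl⟩
  have h := mapClusterPt_one_atTop_pow E
  have hU' : (fun z : Circle => (z : ℂ)) ⁻¹' U ∈ 𝓝 (1 : Circle) :=
    continuous_subtype_val.continuousAt.preimage_mem_nhds (by simpa using hU)
  have h2 := (h.frequently hU').and_eventually (eventually_ge_atTop 1)
  obtain ⟨N, hN, hN1⟩ := h2.exists
  refine ⟨N - 1, ?_⟩
  rw [Nat.sub_add_cancel hN1, ← hE]
  simpa using hN

theorem VD.nonreal {A : Matrix α α ℝ} (hA : VD A) {v : α → ℂ} (hv : v ≠ 0) {lam : ℂ}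
    (h : ∀ i, ∑ j, (A i j : ℂ) * v j = lam * v i) : lam.im = 0 := by
  by_contra him
  have hlam : lam ≠ 0 := by rintro rfl; simp at him
  set w : ℂ → α → ℝ := fun z i => (z * v i).re with hw
  have hAw : ∀ z, A.mulVec (w z) = w (z * lam) := by
    intro z
    funext i
    simp only [hw, Matrix.mulVec, dotProduct]
    rw [mul_assoc, ← h i, Finset.mul_sum, Complex.re_sum]
    refine Finset.sum_congr rfl fun j _ => ?_
    rw [mul_left_comm, Complex.re_ofReal_mul]
  have hw0 : ∀ z, z ≠ 0 → w z ≠ 0 := by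
    intro z hz h0
    have h1 : w (z * lam) = 0 := by rw [← hAw, h0, Matrix.mulVec_zero]
    apply hv
    funext i
    have e0 : (z * v i).re = 0 := congrFun h0 i
    have e1 : (z * lam * v i).re = 0 := congrFun h1 i
    have e2 : z * lam * v i = lam * (z * v i) := by ring
    rw [e2, Complex.mul_re, e0] at e1
    have e3 : (z * v i).im = 0 := by
      have : lam.im * (z * v i).im = 0 := by linarith
      exact (mul_eq_zero.1 this).resolve_left him
    have : z * v i = 0 := Complex.ext e0 e3
    exact (mul_eq_zero.1 this).resolve_left hz
  have hneg : ∀ z, w (-z) = -w z := by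
    intro z; funext i; simp only [hw, Pi.neg_apply, neg_mul, Complex.neg_re]
  obtain ⟨i1, _⟩ := Function.ne_iff.1 hv
  have : Nonempty α := ⟨i1⟩
  obtain ⟨i0, hi0⟩ := Finite.exists_min (id : α → α)
  have iter : ∀ (N k : ℕ) (z : ℂ), z ≠ 0 → (∃ j, SChain (w (z * lam ^ N)) k j) →
      ∃ j, SChain (w z) k j := by
    intro N
    induction N with
    | zero => intro k z _ h; simpa using h
    | succ N ih =>
      intro k z hz h
      obtain ⟨j, hj⟩ := ih k (z * lam) (mul_ne_zero hz hlam) (by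
        rwa [mul_assoc, ← pow_succ'])
      refine hA k (w z) j (hw0 z hz) ?_
      rw [hAw]
      exact hj.weak (fun _ h => h.le) (fun _ h => h.le)
  have step : ∀ k, ∃ z : ℂ, z ≠ 0 ∧ w z i0 = 0 ∧ ∃ i, SChain (w z) k i := by
    intro k
    induction k with
    | zero =>
      obtain ⟨z, hz, hz0⟩ : ∃ z : ℂ, z ≠ 0 ∧ w z i0 = 0 := by
        by_cases hv0 : v i0 = 0
        · exact ⟨1, one_ne_zero, by simp [hw, hv0]⟩
        · refine ⟨Complex.I / v i0, div_ne_zero Complex.I_ne_zero hv0, ?_⟩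
          simp only [hw]
          rw [div_mul_cancel₀ _ hv0, Complex.I_re]
      obtain ⟨i, hi⟩ := Function.ne_iff.1 (hw0 z hz)
      rcases lt_or_gt_of_ne hi with hi | hi
      · refine ⟨-z, neg_ne_zero.2 hz, by rw [hneg]; simp [hz0], i, ?_⟩
        rw [hneg]
        change 0 < - w z i
        simpa using hi
      · exact ⟨z, hz, hz0, i, hi⟩
    | succ k ih =>
      obtain ⟨z, hz, hz0, i, hi⟩ := ih
      have hlt : i0 < i := by
        refine lt_of_le_of_ne (hi0 i) ?_
        rintro rfl
        exact hi.pos.ne' hz0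
      have hW : WChain (w (-z)) (k+1) i0 := by
        refine ⟨by rw [hneg]; simp [hz0], i, hlt, ?_⟩
        rw [hneg, neg_neg]
        exact hi.weak (fun _ h => h.le) (fun _ h => h.le)
      have hz' : -z / lam ≠ 0 := div_ne_zero (neg_ne_zero.2 hz) hlam
      obtain ⟨j, hj⟩ := hA (k+1) (w (-z / lam)) i0 (hw0 _ hz') (by
        rw [hAw, div_mul_cancel₀ _ hlam]; exact hW)
      have hnorm : (0:ℝ) < ‖lam‖ := norm_pos_iff.2 hlam
      have hcont : Continuous (fun e : ℂ => w (-z / lam * e)) := by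
        refine continuous_pi fun m => ?_
        simp only [hw]
        fun_prop
      obtain ⟨N, hN⟩ := exists_pow_near_one (lam / ‖lam‖) (by
          rw [norm_div, Complex.norm_real, norm_norm, div_self hnorm.ne'])
        ((fun e : ℂ => w (-z / lam * e)) ⁻¹' {x | SChain x (k+1) j})
        (((SChain.isOpen (k+1) j).preimage hcont).mem_nhds (by simpa using hj))
      have hN' : SChain (w (-z / lam * (lam / ‖lam‖) ^ (N + 1))) (k+1) j := hN
      have hscale : ∀ m, w (-z * lam ^ N) m =
          ‖lam‖ ^ (N+1) * w (-z / lam * (lam / ‖lam‖) ^ (N + 1)) m := by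
        intro m
        simp only [hw]
        rw [← Complex.re_ofReal_mul]
        congr 1
        have hc : (‖lam‖ : ℂ) ≠ 0 := by exact_mod_cast hnorm.ne'
        push_cast
        rw [div_pow]
        field_simp
        ring
      obtain ⟨j', hj'⟩ := iter N (k+1) (-z) (neg_ne_zero.2 hz) ⟨j, hN'.congr (by
          intro m _ hm
          rw [hscale]
          positivity) (by
          intro m _ hm
          rw [hscale]
          exact mul_neg_of_pos_of_neg (by positivity) hm)⟩
      exact ⟨-z, neg_ne_zero.2 hz, by rw [hneg]; simp [hz0], j', hj'⟩
  obtain ⟨z, _, _, i, hi⟩ := step (Fintype.card α)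
  exact absurd hi.lt_card (lt_irrefl _)

theorem VD.eig_pos {A : Matrix α α ℝ} (hA : VD A) {v : α → ℂ} (hv : v ≠ 0) {lam : ℂ}
    (h : ∀ i, ∑ j, (A i j : ℂ) * v j = lam * v i) : lam.im = 0 ∧ 0 < lam.re := by
  have him := hA.nonreal hv h
  refine ⟨him, ?_⟩
  have hre : ∀ i, ∑ j, A i j * (v j).re = lam.re * (v i).re := by
    intro i
    have := congrArg Complex.re (h i)
    simpa [Complex.re_sum, him] using this
  have him' : ∀ i, ∑ j, A i j * (v j).im = lam.re * (v i).im := by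
    intro i
    have := congrArg Complex.im (h i)
    simpa [Complex.im_sum, him] using this
  by_cases h0 : (fun i => (v i).re) = 0
  · refine hA.real_pos (x := fun i => (v i).im) ?_ (funext him')
    intro h1
    exact hv (funext fun i => Complex.ext (congrFun h0 i) (congrFun h1 i))
  · exact hA.real_pos h0 (funext hre)
end

section
attribute [local instance] Matrix.linftyOpNormedRing Matrix.linftyOpNormedAlgebra

theorem pow_tendsto_zero_of_eig {m : ℕ} (B : Matrix (Fin (m+1)) (Fin (m+1)) ℂ)
    (hB : ∀ (lam : ℂ) (v : Fin (m+1) → ℂ), v ≠ 0 → B.mulVec v = lam • v → ‖lam‖ < 1) :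
    Tendsto (fun k : ℕ => B ^ k) atTop (𝓝 0) := by
  have hsp : spectralRadius ℂ B < (1 : NNReal) := by
    apply spectrum.spectralRadius_lt_of_forall_lt
    intro lam hl
    rw [← Matrix.spectrum_toLin'] at hl
    obtain ⟨v, hv⟩ := (Module.End.HasEigenvalue.of_mem_spectrum hl).exists_hasEigenvector
    have := hB lam v hv.2 (by simpa using hv.apply_eq_smul)
    exact_mod_cast this
  have hg := spectrum.pow_nnnorm_pow_one_div_tendsto_nhds_spectralRadius B
  obtain ⟨r, hr1, hr2⟩ := exists_between hsp
  have hev := hg.eventually (gt_mem_nhds hr1)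
  lift r to NNReal using (hr2.trans ENNReal.coe_lt_top).ne
  have hr2' : r < 1 := by exact_mod_cast hr2
  refine tendsto_zero_iff_norm_tendsto_zero.2 ?_
  refine squeeze_zero' (Eventually.of_forall fun _ => norm_nonneg _) ?_
    (tendsto_pow_atTop_nhds_zero_of_lt_one r.2 (by exact_mod_cast hr2' : (r : ℝ) < 1))
  filter_upwards [hev, eventually_gt_atTop 0] with k hk hk0
  have h1 : ((‖B ^ k‖₊ : ENNReal) ^ (1 / k : ℝ)) ^ (k : ℝ) ≤ (r : ENNReal) ^ (k : ℝ) :=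
    ENNReal.rpow_le_rpow hk.le (by positivity)
  rw [← ENNReal.rpow_mul, one_div_mul_cancel (by positivity), ENNReal.rpow_one,
    ENNReal.rpow_natCast] at h1
  exact_mod_cast h1
end

open Filter Topology

section
variable (n : ℕ) (a c : Fin (n + 1) → ℝ) (l : ℝ) (ω : Fin (n + 1) → ℝ)

theorem gtBernstein_nonneg (hc : ∀ i, 0 < c i) (hl : 0 < l) (i : Fin (n+1)) (t : ℝ)
    (h0 : a 0 ≤ t) (h1 : t ≤ a (Fin.last n)) : 0 ≤ gtBernstein n a c l i t := by
  have := hc i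
  have h2 : 0 ≤ l * (t - a 0) := mul_nonneg hl.le (by linarith)
  have h3 : 0 ≤ l * (a (Fin.last n) - t) := mul_nonneg hl.le (by linarith)
  unfold gtBernstein
  positivity

theorem gtBernstein_left (ha : StrictMono a) (hl : 0 < l) (j : Fin (n+1)) (hj : j ≠ 0) :
    gtBernstein n a c l j (a 0) = 0 := by
  have : a 0 < a j := ha (Fin.pos_iff_ne_zero.2 hj)
  unfold gtBernstein
  rw [sub_self, mul_zero, Real.zero_rpow (mul_pos hl (by linarith)).ne']
  simp

theorem gtBernstein_right (ha : StrictMono a) (hl : 0 < l) (j : Fin (n+1)) (hj : j ≠ Fin.last n) :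
    gtBernstein n a c l j (a (Fin.last n)) = 0 := by
  have : a j < a (Fin.last n) := ha (Fin.lt_last_iff_ne_last.2 hj)
  unfold gtBernstein
  rw [sub_self (a (Fin.last n)), mul_zero, Real.zero_rpow (mul_pos hl (by linarith)).ne']
  simp

theorem gtBernstein_exists_pos (ha : StrictMono a) (hc : ∀ i, 0 < c i) (hl : 0 < l) (t : ℝ)
    (h0 : a 0 ≤ t) (h1 : t ≤ a (Fin.last n)) : ∃ i, 0 < gtBernstein n a c l i t := by
  rcases h1.lt_or_eq with h1 | h1
  · refine ⟨0, ?_⟩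
    have := hc 0
    have h3 : 0 < l * (a (Fin.last n) - t) := mul_pos hl (by linarith)
    unfold gtBernstein
    rw [sub_self (a 0), mul_zero, Real.rpow_zero]
    positivity
  · refine ⟨Fin.last n, ?_⟩
    have := hc (Fin.last n)
    unfold gtBernstein
    rw [sub_self (a (Fin.last n)), mul_zero, Real.rpow_zero]
    rcases h0.lt_or_eq with h0 | h0
    · have h3 : 0 < l * (t - a 0) := mul_pos hl (by linarith)
      positivity
    · rw [← h1, ← h0, sub_self, mul_zero, Real.rpow_zero]
      positivity

theorem gt_sum_pos (ha : StrictMono a) (hc : ∀ i, 0 < c i) (hl : 0 < l) (hω : ∀ i, 0 < ω i)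
    (t : ℝ) (h0 : a 0 ≤ t) (h1 : t ≤ a (Fin.last n)) :
    0 < ∑ j, ω j * gtBernstein n a c l j t := by
  obtain ⟨i, hi⟩ := gtBernstein_exists_pos n a c l ha hc hl t h0 h1
  exact Finset.sum_pos' (fun j _ => mul_nonneg (hω j).le
    (gtBernstein_nonneg n a c l hc hl j t h0 h1)) ⟨i, Finset.mem_univ i, mul_pos (hω i) hi⟩

/-- interior factorization -/
theorem ratGT_factor (hl : 0 < l) (j : Fin (n+1)) (t : ℝ)
    (h0 : a 0 < t) (h1 : t < a (Fin.last n)) :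
    ratGTBernstein n a c l ω j t =
      (Real.exp (Real.log (l * (a (Fin.last n) - t)) * (l * a (Fin.last n))
          - Real.log (l * (t - a 0)) * (l * a 0)) / ∑ j, ω j * gtBernstein n a c l j t) *
        Real.exp ((Real.log (l * (t - a 0)) - Real.log (l * (a (Fin.last n) - t))) * (l * a j)) *
        (ω j * c j) := by
  have hX : 0 < l * (t - a 0) := mul_pos hl (by linarith)
  have hY : 0 < l * (a (Fin.last n) - t) := mul_pos hl (by linarith)
  have key : gtBernstein n a c l j t = c j *
      (Real.exp (Real.log (l * (a (Fin.last n) - t)) * (l * a (Fin.last n))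
          - Real.log (l * (t - a 0)) * (l * a 0)) *
      Real.exp ((Real.log (l * (t - a 0)) - Real.log (l * (a (Fin.last n) - t))) * (l * a j))) := by
    unfold gtBernstein
    rw [Real.rpow_def_of_pos hX, Real.rpow_def_of_pos hY, mul_assoc, ← Real.exp_add,
      ← Real.exp_add]
    ring_nf
  unfold ratGTBernstein
  rw [key]
  ring
end

theorem gt_pow_tendsto
    (n : ℕ) (a c : Fin (n + 1) → ℝ) (l : ℝ) (ω : Fin (n + 1) → ℝ)
    (ha : StrictMono a) (hc : ∀ i, 0 < c i) (hl : 0 < l) (hω : ∀ i, 0 < ω i)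
    (t : Fin (n + 1) → ℝ) (ht : StrictMono t)
    (ht0 : a 0 ≤ t 0) (htn : t (Fin.last n) ≤ a (Fin.last n))
    (M : Matrix (Fin (n + 1)) (Fin (n + 1)) ℝ)
    (hM : M = Matrix.of fun i j : Fin (n + 1) => ratGTBernstein n a c l ω j (t i)) :
    Tendsto (fun k : ℕ => (1 - M) ^ k) atTop (𝓝 0) := by
  have hMij : ∀ i j, M i j = ratGTBernstein n a c l ω j (t i) := fun i j => by rw [hM]; rfl
  have hti0 : ∀ i, a 0 ≤ t i := fun i => ht0.trans (ht.monotone (Fin.zero_le i))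
  have htin : ∀ i, t i ≤ a (Fin.last n) := fun i => (ht.monotone (Fin.le_last i)).trans htn
  have hS : ∀ i, 0 < ∑ j, ω j * gtBernstein n a c l j (t i) := fun i =>
    gt_sum_pos n a c l ω ha hc hl hω (t i) (hti0 i) (htin i)
  have hnn : ∀ i j, 0 ≤ M i j := fun i j => by
    rw [hMij]
    exact div_nonneg (mul_nonneg (hω j).le
      (gtBernstein_nonneg n a c l hc hl j _ (hti0 i) (htin i))) (hS i).le
  have hsum : ∀ i, ∑ j, M i j = 1 := fun i => by
    simp only [hMij, ratGTBernstein]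
    rw [← Finset.sum_div, div_self (hS i).ne']
  have hbd : ∀ i, ¬ (a 0 < t i ∧ t i < a (Fin.last n)) → ∀ j, j ≠ i → M i j = 0 := by
    intro i hi j hj
    rw [hMij]
    have : t i = a 0 ∨ t i = a (Fin.last n) := by
      by_contra! hcon
      exact hi ⟨lt_of_le_of_ne (hti0 i) hcon.1.symm, lt_of_le_of_ne (htin i) hcon.2⟩
    rcases this with h | h
    · have hi0 : i = 0 := by
        refine le_antisymm (ht.le_iff_le.1 ?_) (Fin.zero_le i)
        rw [h]; exact ht0
      subst hi0
      rw [h, ratGTBernstein, gtBernstein_left n a c l ha hl j hj]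
      simp
    · have hi0 : i = Fin.last n := by
        refine le_antisymm (Fin.le_last i) (ht.le_iff_le.1 ?_)
        rw [h]; exact htn
      subst hi0
      rw [h, ratGTBernstein, gtBernstein_right n a c l ha hl j hj]
      simp
  have hbd1 : ∀ i, ¬ (a 0 < t i ∧ t i < a (Fin.last n)) → M i i = 1 := by
    intro i hi
    rw [← hsum i, Finset.sum_eq_single i (fun j _ hj => hbd i hi j hj) (by simp)]
  have heig : ∀ (lam : ℂ) (v : Fin (n+1) → ℂ), v ≠ 0 →
      (∀ i, ∑ j, (M i j : ℂ) * v j = lam * v i) → lam.im = 0 ∧ 0 < lam.re := by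
    intro lam v hv h
    by_cases hl1 : lam = 1
    · subst hl1; simp
    let ι := {i : Fin (n+1) // a 0 < t i ∧ t i < a (Fin.last n)}
    have hv0 : ∀ i, ¬ (a 0 < t i ∧ t i < a (Fin.last n)) → v i = 0 := by
      intro i hi
      have h1 := h i
      rw [Finset.sum_eq_single i (fun j _ hj => by rw [hbd i hi j hj]; simp) (by simp),
        hbd1 i hi] at h1
      have h2 : (1 - lam) * v i = 0 := by
        push_cast at h1
        linear_combination h1
      exact (mul_eq_zero.1 h2).resolve_left (sub_ne_zero.2 (Ne.symm hl1))
    let A : Matrix ι ι ℝ := fun i j => M i.1 j.1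
    have hVD : VD A := by
      intro k x i hx hw
      refine vd_matrix A
        (fun i => (Real.exp (Real.log (l * (a (Fin.last n) - t i.1)) * (l * a (Fin.last n))
          - Real.log (l * (t i.1 - a 0)) * (l * a 0)) /
            ∑ j, ω j * gtBernstein n a c l j (t i.1)))
        (fun i => Real.log (l * (t i.1 - a 0)) - Real.log (l * (a (Fin.last n) - t i.1)))
        (fun j => l * a j.1) (fun j => ω j.1 * c j.1) ?_ ?_ ?_ ?_ ?_ hx hw
      · intro i
        exact div_pos (Real.exp_pos _) (hS i.1)
      · intro i
        exact mul_pos (hω _) (hc _)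
      · intro i j hij
        have h1 : t i.1 < t j.1 := ht hij
        have hi := i.2
        have hj := j.2
        have e1 : Real.log (l * (t i.1 - a 0)) < Real.log (l * (t j.1 - a 0)) :=
          Real.log_lt_log (mul_pos hl (by linarith)) (mul_lt_mul_of_pos_left (by linarith) hl)
        have e2 : Real.log (l * (a (Fin.last n) - t j.1)) <
            Real.log (l * (a (Fin.last n) - t i.1)) :=
          Real.log_lt_log (mul_pos hl (by linarith)) (mul_lt_mul_of_pos_left (by linarith) hl)
        change _ - _ < _ - _
        linarith
      · intro i j hij
        exact mul_lt_mul_of_pos_left (ha hij) hl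
      · intro i j
        change M i.1 j.1 = _
        rw [hMij, ratGT_factor n a c l ω hl j.1 (t i.1) i.2.1 i.2.2]
    refine hVD.eig_pos (v := fun i => v i.1) ?_ (lam := lam) ?_
    · intro h0
      apply hv
      funext i
      by_cases hi : a 0 < t i ∧ t i < a (Fin.last n)
      · exact congrFun h0 ⟨i, hi⟩
      · exact hv0 i hi
    · intro i
      rw [← h i.1]
      refine Finset.sum_of_injOn (fun j : ι => j.1) (Subtype.val_injective.injOn) (by simp) ?_
        (fun _ _ => rfl)
      intro j _ hj
      rw [hv0 j, mul_zero]
      intro hj'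
      exact hj ⟨⟨j, hj'⟩, by simp, rfl⟩
  have hle : ∀ (lam : ℂ) (v : Fin (n+1) → ℂ), v ≠ 0 →
      (∀ i, ∑ j, (M i j : ℂ) * v j = lam * v i) → ‖lam‖ ≤ 1 := by
    intro lam v hv h
    obtain ⟨i, hi⟩ := Finite.exists_max (fun i => ‖v i‖)
    have hpos : 0 < ‖v i‖ := by
      obtain ⟨j, hj⟩ := Function.ne_iff.1 hv
      exact (norm_pos_iff.2 hj).trans_le (hi j)
    have h1 : ‖lam‖ * ‖v i‖ ≤ 1 * ‖v i‖ := by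
      rw [← norm_mul, ← h i, ← hsum i, Finset.sum_mul]
      refine (norm_sum_le _ _).trans (Finset.sum_le_sum fun j _ => ?_)
      rw [norm_mul, Complex.norm_real, Real.norm_of_nonneg (hnn i j)]
      exact mul_le_mul_of_nonneg_left (hi j) (hnn i j)
    exact le_of_mul_le_mul_right h1 hpos
  have hC := pow_tendsto_zero_of_eig ((1 - M).map (Complex.ofRealHom)) (by
    intro μ v hv h
    have h' : ∀ i, ∑ j, (M i j : ℂ) * v j = (1 - μ) * v i := by
      intro i
      have := congrFun h i
      rw [Matrix.map_sub (Complex.ofRealHom) (by simp), Matrix.map_one _ (by simp) (by simp),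
        Matrix.sub_mulVec, Matrix.one_mulVec] at this
      simp only [Matrix.mulVec, dotProduct, Pi.sub_apply, Pi.smul_apply, smul_eq_mul,
        Matrix.map_apply, Complex.ofRealHom_eq_coe] at this
      linear_combination -this
    obtain ⟨h1, h2⟩ := heig _ v hv h'
    have h3 := hle _ v hv h'
    have e1 : μ.im = 0 := by simpa using h1
    have e2 : μ.re < 1 := by simpa using h2
    have h4 := (Complex.re_le_norm (1 - μ)).trans h3
    have e3 : 0 ≤ μ.re := by simpa using h4
    have : μ = (μ.re : ℂ) := Complex.ext (by simp) (by simpa using e1)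
    rw [this, Complex.norm_real, Real.norm_of_nonneg e3]
    exact e2)
  refine tendsto_pi_nhds.2 fun i => tendsto_pi_nhds.2 fun j => ?_
  have hCij := tendsto_pi_nhds.1 (tendsto_pi_nhds.1 hC i) j
  have := (Complex.continuous_re.tendsto _).comp hCij
  refine this.congr' (Eventually.of_forall fun k => ?_)
  have e : (1 - M).map (Complex.ofRealHom) ^ k = ((1 - M) ^ k).map (Complex.ofRealHom) :=
    (map_pow (Complex.ofRealHom.mapMatrix) (1 - M) k).symm
  simp only [Function.comp]
  rw [e]
  simp

/-- The GT-Bézier curve has the progressive iterative approximation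
property. With `M = [𝒯_{a_j}(t_i)]` the collocation matrix at parameters
`a 0 ≤ t 0 < t 1 < ⋯ < t n ≤ a n`, control points `P i ∈ ℝ^d`, and the PIA iteration
`Q 0 = P`, `Q (k+1) i = Q k i + (P i − Σ_j M i j • Q k j)`, the value of the `k`-th
iterated curve at `t i` converges to `P i` for every `i`; equivalently,
`(I − M)^k → 0` as `k → ∞`. -/
theorem gtBezier_progressive_iterative_approximation
    (n : ℕ) (a c : Fin (n + 1) → ℝ) (l : ℝ) (ω : Fin (n + 1) → ℝ)
    (ha : StrictMono a) (hc : ∀ i, 0 < c i) (hl : 0 < l) (hω : ∀ i, 0 < ω i)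
    (t : Fin (n + 1) → ℝ) (ht : StrictMono t)
    (ht0 : a 0 ≤ t 0) (htn : t (Fin.last n) ≤ a (Fin.last n))
    (M : Matrix (Fin (n + 1)) (Fin (n + 1)) ℝ)
    (hM : M = Matrix.of fun i j : Fin (n + 1) => ratGTBernstein n a c l ω j (t i))
    (d : ℕ) (P : Fin (n + 1) → (Fin d → ℝ))
    (Q : ℕ → Fin (n + 1) → (Fin d → ℝ))
    (hQ0 : Q 0 = P)
    (hQ : ∀ (k : ℕ) (i : Fin (n + 1)),
      Q (k + 1) i = Q k i + (P i - ∑ j, M i j • Q k j)) :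
    (∀ i : Fin (n + 1),
        Tendsto (fun k : ℕ => ∑ j, M i j • Q k j) atTop (𝓝 (P i))) ∧
      Tendsto (fun k : ℕ => (1 - M) ^ k) atTop (𝓝 0) := by
  have hpow := gt_pow_tendsto n a c l ω ha hc hl hω t ht ht0 htn M hM
  refine ⟨?_, hpow⟩
  intro i
  have herr : ∀ k i, P i - ∑ j, M i j • Q k j =
      ∑ m, ((1 - M) ^ k) i m • (P m - ∑ j, M m j • P j) := by
    intro k
    induction k with
    | zero =>
      intro i
      simp [hQ0, Matrix.one_apply]
    | succ k ih =>
      intro i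
      have h1 : P i - ∑ j, M i j • Q (k+1) j =
          ∑ m, (1 - M) i m • (P m - ∑ j, M m j • Q k j) := by
        simp only [hQ, Matrix.sub_apply, sub_smul, Finset.sum_sub_distrib, Matrix.one_apply,
          ite_smul, one_smul, zero_smul, Finset.sum_ite_eq, Finset.mem_univ, if_true, smul_add,
          Finset.sum_add_distrib]
        abel
      rw [h1, pow_succ']
      simp only [ih, Matrix.mul_apply, Finset.sum_smul, Finset.smul_sum, mul_smul]
      exact Finset.sum_comm
  have hlim : Tendsto (fun k : ℕ => P i - ∑ m, ((1 - M) ^ k) i m • (P m - ∑ j, M m j • P j))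
      atTop (𝓝 (P i - ∑ m, (0 : ℝ) • (P m - ∑ j, M m j • P j))) := by
    refine tendsto_const_nhds.sub (tendsto_finsetSum _ fun m _ => Tendsto.smul_const ?_ _)
    exact tendsto_pi_nhds.1 (tendsto_pi_nhds.1 hpow i) m
  simp only [zero_smul, Finset.sum_const_zero, sub_zero] at hlim
  refine hlim.congr fun k => ?_
  rw [← herr, sub_sub_cancel]
end

section
/- Let X be an n×m real matrix. If every minor of X formed by k consecutive rows and k consecutive columns is strictly positive, for every k = 1, 2, …, min{n, m}, then X is strictly totally positive: every minor of X (formed by arbitrary rows i_1 < ⋯ < i_k and arbitrary columns j_1 < ⋯ < j_k) is strictly positive. -/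
/-- A real matrix is strictly totally positive if every minor (determinant of the
submatrix obtained by selecting rows `r 0 < r 1 < ⋯` and columns `c 0 < c 1 < ⋯`)
is strictly positive. -/
def IsStrictlyTotallyPositive {N M : ℕ} (A : Matrix (Fin N) (Fin M) ℝ) : Prop :=
  ∀ (k : ℕ) (r : Fin k → Fin N) (c : Fin k → Fin M),
    StrictMono r → StrictMono c → 0 < (A.submatrix r c).det

/-- Determinant of the matrix with columns `u`, `v`, followed by the columns of `C`. -/
noncomputable def brk {s : ℕ} (C : Fin (s+2) → Fin s → ℝ) (u v : Fin (s+2) → ℝ) : ℝ :=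
  Matrix.det (Matrix.of fun i => Matrix.vecCons (u i) (Matrix.vecCons (v i) (C i)))

/-- Expansion along the first column. -/
lemma brk_expand {s : ℕ} (C : Fin (s+2) → Fin s → ℝ) (u v : Fin (s+2) → ℝ) :
    brk C u v = ∑ p : Fin (s+2), (-1 : ℝ) ^ (p : ℕ) * u p *
      Matrix.det (Matrix.of fun i : Fin (s+1) =>
        Matrix.vecCons (v (p.succAbove i)) (C (p.succAbove i))) := by
  unfold brk
  rw [Matrix.det_succ_column_zero]
  rfl

lemma brk_single {s : ℕ} (C : Fin (s+2) → Fin s → ℝ) (p : Fin (s+2)) (v : Fin (s+2) → ℝ) :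
    brk C (Pi.single p 1) v = (-1 : ℝ) ^ (p : ℕ) *
      Matrix.det (Matrix.of fun i : Fin (s+1) =>
        Matrix.vecCons (v (p.succAbove i)) (C (p.succAbove i))) := by
  rw [brk_expand, Finset.sum_eq_single p]
  · simp
  · intro b _ hb
    simp [Pi.single_eq_of_ne hb]
  · simp

lemma brk_single_single {s : ℕ} (C : Fin (s+2) → Fin s → ℝ) (p : Fin (s+2)) (b : Fin (s+1)) :
    brk C (Pi.single p 1) (Pi.single (p.succAbove b) 1) = (-1 : ℝ) ^ (p : ℕ) * ((-1) ^ (b : ℕ) *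
      Matrix.det (Matrix.of fun i : Fin s => C (p.succAbove (b.succAbove i)))) := by
  rw [brk_single, Matrix.det_succ_column_zero, Finset.sum_eq_single b]
  · simp
    rfl
  · intro c _ hc
    have : p.succAbove c ≠ p.succAbove b := fun h => hc (Fin.succAbove_right_injective h)
    simp [Pi.single_eq_of_ne this]
  · simp

lemma brk_plucker {s : ℕ} (C : Fin (s+2) → Fin s → ℝ) (a b c x : Fin (s+2) → ℝ) :
    brk C c x * brk C a b = brk C a x * brk C c b + brk C b x * brk C a c := by
  set B : Matrix (Fin (s+2)) (Fin (s+2)) ℝ :=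
    Matrix.of fun i => Matrix.vecCons (a i) (Matrix.vecCons (b i) (C i)) with hB
  have hcr := Matrix.mulVec_cramer B c
  have hw0 : Matrix.cramer B c 0 = brk C c b := by
    rw [Matrix.cramer_apply, brk]
    congr 1
    ext i j
    refine Fin.cases ?_ (fun j => ?_) j
    · simp
    · simp [hB, Fin.succ_ne_zero]
  have hw1 : Matrix.cramer B c 1 = brk C a c := by
    rw [Matrix.cramer_apply, brk]
    congr 1
    ext i j
    refine Fin.cases ?_ (fun j => Fin.cases ?_ (fun j => ?_) j) j
    · simp [hB]
    · simp
    · have : j.succ.succ ≠ (1 : Fin (s+2)) := by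
        simp [Fin.ext_iff]
      simp [hB, this]
  set w := Matrix.cramer B c
  have h1 : brk C (B.det • c) x = B.det * brk C c x := by
    rw [brk_expand, brk_expand, Finset.mul_sum]
    refine Finset.sum_congr rfl fun p _ => ?_
    simp only [Pi.smul_apply, smul_eq_mul]; ring
  have h2 : brk C (B.mulVec w) x = ∑ j, w j * brk C (fun i => B i j) x := by
    simp only [brk_expand, Finset.mul_sum]
    rw [Finset.sum_comm]
    refine Finset.sum_congr rfl fun p _ => ?_
    simp only [Matrix.mulVec, dotProduct, Finset.mul_sum, Finset.sum_mul]
    refine Finset.sum_congr rfl fun q _ => ?_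
    ring
  have h3 : ∀ j : Fin s, brk C (fun i => C i j) x = 0 := by
    intro j
    refine Matrix.det_zero_of_column_eq (i := 0) (j := j.succ.succ) (Fin.succ_ne_zero _).symm ?_
    intro k
    simp
  rw [Fin.sum_univ_succ, Fin.sum_univ_succ, Finset.sum_eq_zero] at h2
  · rw [hcr, h1] at h2
    have e0 : (fun i => B i 0) = a := by ext i; simp [hB]
    have e1 : (fun i => B i (Fin.succ 0)) = b := by ext i; simp [hB]
    rw [e0, e1, hw0, Fin.succ_zero_eq_one, hw1] at h2
    have hd : B.det = brk C a b := rfl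
    rw [hd] at h2
    linarith
  · intro j _
    have : (fun i => B i j.succ.succ) = fun i => C i j := by ext i; simp [hB]
    rw [this, h3, mul_zero]

/-- The three-term relation between minors. -/
lemma three_term {s : ℕ} (G : Fin (s+2) → Fin (s+1) → ℝ) (a : Fin (s+1))
    (ha : a.succ ≠ Fin.last (s+1)) :
    Matrix.det (Matrix.of fun i => G (a.succ.succAbove i)) *
      Matrix.det (Matrix.of fun (i : Fin s) (j : Fin s) =>
        G ((0 : Fin (s+2)).succAbove ((Fin.last s).succAbove i)) j.succ) =
    Matrix.det (Matrix.of fun i => G ((0 : Fin (s+2)).succAbove i)) *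
      Matrix.det (Matrix.of fun (i : Fin s) (j : Fin s) =>
        G (a.succ.succAbove ((Fin.last s).succAbove i)) j.succ) +
    Matrix.det (Matrix.of fun i => G ((Fin.last (s+1)).succAbove i)) *
      Matrix.det (Matrix.of fun (i : Fin s) (j : Fin s) =>
        G ((0 : Fin (s+2)).succAbove (a.succAbove i)) j.succ) := by
  set C : Fin (s+2) → Fin s → ℝ := fun i j => G i j.succ with hC
  have key := brk_plucker C (Pi.single 0 1) (Pi.single (Fin.last (s+1)) 1) (Pi.single a.succ 1)
    (fun i => G i 0)
  have hG : ∀ i, Matrix.vecCons (G i 0) (C i) = G i := by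
    intro i
    ext j
    refine Fin.cases ?_ (fun j => ?_) j <;> simp [hC]
  have e1 := brk_single_single C 0 (Fin.last s)
  have e2 := brk_single_single C a.succ (Fin.last s)
  have e3 := brk_single_single C 0 a
  rw [show (0 : Fin (s+2)).succAbove (Fin.last s) = Fin.last (s+1) by simp] at e1
  rw [Fin.succAbove_ne_last_last ha] at e2
  rw [Fin.succAbove_zero_apply] at e3
  rw [e1, e2, e3, brk_single, brk_single, brk_single] at key
  simp only [hG] at key
  simp only [Fin.val_zero, Fin.val_last, Fin.val_succ, pow_zero, one_mul] at key
  have hs : ((-1 : ℝ) ^ ((a : ℕ) + 1) * (-1) ^ s) * ((-1 : ℝ) ^ ((a : ℕ) + 1) * (-1) ^ s) = 1 := by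
    rw [← pow_add, ← mul_pow]; simp
  have hs' : ((-1 : ℝ) ^ ((a : ℕ) + 1) * (-1) ^ s) ≠ 0 := by
    intro h; rw [h] at hs; simp at hs
  apply mul_left_cancel₀ hs'
  simp only [pow_succ] at key ⊢
  linear_combination key

lemma insertNth_strictMono {s : ℕ} (r : Fin (s+1) → ℕ) (hr : StrictMono r) (i : Fin s)
    (p : ℕ) (h1 : r i.castSucc < p) (h2 : p < r i.succ) :
    StrictMono (Fin.insertNth (α := fun _ => ℕ) (i.castSucc.succ) p r) := by
  intro x y hxy
  rcases Fin.eq_self_or_eq_succAbove i.castSucc.succ x with rfl | ⟨x, rfl⟩ <;>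
  rcases Fin.eq_self_or_eq_succAbove i.castSucc.succ y with rfl | ⟨y, rfl⟩
  · exact absurd hxy (lt_irrefl _)
  · rw [Fin.insertNth_apply_same, Fin.insertNth_apply_succAbove]
    refine h2.trans_le (hr.monotone ?_)
    rw [Fin.lt_succAbove_iff_le_castSucc] at hxy
    rw [Fin.le_def] at hxy ⊢
    simpa using hxy
  · rw [Fin.insertNth_apply_same, Fin.insertNth_apply_succAbove]
    refine (hr.monotone ?_).trans_lt h1
    rw [Fin.succAbove_lt_iff_castSucc_lt] at hxy
    rw [Fin.lt_def] at hxy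
    rw [Fin.le_def]
    simp at hxy ⊢
    omega
  · rw [Fin.insertNth_apply_succAbove, Fin.insertNth_apply_succAbove]
    exact hr ((Fin.strictMono_succAbove _).lt_iff_lt.1 hxy)

/-- Positivity of all maximal minors from the consecutive ones. -/
lemma rows_pos (s n : ℕ) (G : ℕ → Fin (s+1) → ℝ)
    (hsub : ∀ r : Fin s → ℕ, StrictMono r → (∀ i, r i < n) →
      0 < Matrix.det (Matrix.of fun i (j : Fin s) => G (r i) j.succ))
    (hcons : ∀ r0, r0 + (s+1) ≤ n →
      0 < Matrix.det (Matrix.of fun (i : Fin (s+1)) => G (r0 + i))) :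
    ∀ (d : ℕ) (r : Fin (s+1) → ℕ), StrictMono r → (∀ i, r i < n) → r (Fin.last s) - r 0 = d →
      0 < Matrix.det (Matrix.of fun i => G (r i)) := by
  intro d
  induction d using Nat.strong_induction_on with
  | _ d ih =>
  intro r hr hn hd
  by_cases hgap : ∃ i : Fin s, r i.castSucc + 1 < r i.succ
  · obtain ⟨i, hi⟩ := hgap
    set t : Fin (s+2) → ℕ :=
      Fin.insertNth (α := fun _ => ℕ) (i.castSucc.succ) (r i.castSucc + 1) r with ht
    have htm : StrictMono t := insertNth_strictMono r hr i _ (Nat.lt_succ_self _) hi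
    have htr : ∀ j, t (i.castSucc.succ.succAbove j) = r j := fun j =>
      Fin.insertNth_apply_succAbove (α := fun _ => ℕ) _ _ _ _
    have hne : i.castSucc.succ ≠ Fin.last (s+1) := by
      have := i.isLt
      simp [Fin.ext_iff]
      omega
    have ht0 : t 0 = r 0 := by
      rw [← htr 0, Fin.succAbove_ne_zero_zero (Fin.succ_ne_zero _)]
    have htl : t (Fin.last (s+1)) = r (Fin.last s) := by
      rw [← htr (Fin.last s), Fin.succAbove_ne_last_last hne]
    have htn : ∀ j, t j < n := fun j =>
      (htm.monotone (Fin.le_last j)).trans_lt (htl ▸ hn _)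
    have key := three_term (fun j => G (t j)) i.castSucc hne
    have hfr : (Matrix.of fun j => G (t (i.castSucc.succ.succAbove j))) =
        Matrix.of fun j => G (r j) := by simp only [htr]
    rw [hfr] at key
    have hm : ∀ (x : Fin (s+2)) (y : Fin (s+1)), 0 < Matrix.det (Matrix.of fun (i : Fin s)
        (j : Fin s) => G (t (x.succAbove (y.succAbove i))) j.succ) := fun x y =>
      hsub _ (htm.comp ((Fin.strictMono_succAbove x).comp (Fin.strictMono_succAbove y)))
        (fun _ => htn _)
    have hsp : 0 < s := i.pos
    have hlt : r 0 < r (Fin.last s) := hr (by rw [Fin.lt_def]; simpa using hsp)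
    have hM0 : 0 < Matrix.det (Matrix.of fun i => G (t ((0 : Fin (s+2)).succAbove i))) := by
      refine ih _ ?_ (fun i => t ((0 : Fin (s+2)).succAbove i))
        (htm.comp (Fin.strictMono_succAbove _)) (fun _ => htn _) rfl
      have e1 : t 0 < t ((0 : Fin (s+2)).succAbove 0) := htm (by simp)
      have e2 : (0 : Fin (s+2)).succAbove (Fin.last s) = Fin.last (s+1) := by simp
      simp only [e2]
      omega
    have hMl : 0 < Matrix.det (Matrix.of fun i => G (t ((Fin.last (s+1)).succAbove i))) := by
      refine ih _ ?_ (fun i => t ((Fin.last (s+1)).succAbove i))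
        (htm.comp (Fin.strictMono_succAbove _)) (fun _ => htn _) rfl
      have e1 : t ((Fin.last (s+1)).succAbove (Fin.last s)) < t (Fin.last (s+1)) :=
        htm (by simp [Fin.lt_def])
      have e2 : (Fin.last (s+1)).succAbove (0 : Fin (s+1)) = 0 := by simp
      simp only [e2]
      omega
    refine pos_of_mul_pos_left ?_ (hm 0 (Fin.last s)).le
    rw [key]
    exact add_pos (mul_pos hM0 (hm _ _)) (mul_pos hMl (hm _ _))
  · push Not at hgap
    have hc : ∀ i : Fin (s+1), r i = r 0 + i := by
      intro i
      induction i using Fin.induction with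
      | zero => simp
      | succ i ihi =>
        have := hgap i
        have := hr (Fin.castSucc_lt_succ (i := i))
        simp at ihi ⊢
        omega
    have hh : r 0 + (s+1) ≤ n := by
      have := hn (Fin.last s)
      rw [hc] at this
      simp at this
      omega
    have hfr : (Matrix.of fun i => G (r i)) =
        Matrix.of fun (i : Fin (s+1)) => G (r 0 + (i : ℕ)) := by
      ext i j
      exact congrFun (congrArg G (hc i)) j
    rw [hfr]
    exact hcons (r 0) hh

/-- All row choices, consecutive columns. -/
lemma cons_cols_pos (n m : ℕ) (Y : ℕ → ℕ → ℝ)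
    (h : ∀ k r0 c0 : ℕ, r0 + k ≤ n → c0 + k ≤ m →
      0 < Matrix.det (Matrix.of fun (i j : Fin k) => Y (r0 + i) (c0 + j))) :
    ∀ (k c0 : ℕ), c0 + k ≤ m → ∀ r : Fin k → ℕ, StrictMono r → (∀ i, r i < n) →
      0 < Matrix.det (Matrix.of fun (i j : Fin k) => Y (r i) (c0 + j)) := by
  intro k
  induction k with
  | zero => intros; simp
  | succ s ih =>
    intro c0 hc0 r hr hn
    refine rows_pos s n (fun i j => Y i (c0 + j)) ?_ ?_ _ r hr hn rfl
    · intro r hr hn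
      have := ih (c0 + 1) (by omega) r hr hn
      simpa [add_assoc, add_comm, add_left_comm] using this
    · intro r0 hr0
      exact h _ _ _ hr0 hc0

lemma all_pos (n m : ℕ) (Y : ℕ → ℕ → ℝ)
    (h : ∀ k r0 c0 : ℕ, r0 + k ≤ n → c0 + k ≤ m →
      0 < Matrix.det (Matrix.of fun (i j : Fin k) => Y (r0 + i) (c0 + j))) :
    ∀ (k : ℕ) (r c : Fin k → ℕ), StrictMono r → (∀ i, r i < n) → StrictMono c →
      (∀ i, c i < m) → 0 < Matrix.det (Matrix.of fun (i j : Fin k) => Y (r i) (c j)) := by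
  intro k
  induction k with
  | zero => intros; simp
  | succ s ih =>
    intro r c hr hn hc hm
    rw [← Matrix.det_transpose]
    refine rows_pos s m (fun i j => Y (r j) i) ?_ ?_ _ c hc hm rfl
    · intro c hc hm
      have := ih (fun i => r i.succ) c (hr.comp (Fin.strictMono_succ)) (fun _ => hn _) hc hm
      rw [← Matrix.det_transpose] at this
      exact this
    · intro c0 hc0
      have := cons_cols_pos n m Y h _ c0 hc0 r hr hn
      rw [← Matrix.det_transpose] at this
      exact this

/-- If every minor of an `n × m` real matrix `X` formed by `k`
consecutive rows (starting at row `r0`) and `k` consecutive columns (starting at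
column `c0`) is strictly positive, for every `k ≥ 1`, then `X` is strictly totally
positive. -/
theorem strictlyTotallyPositive_of_consecutive_minors_pos
    (n m : ℕ) (X : Matrix (Fin n) (Fin m) ℝ)
    (h : ∀ (k r0 c0 : ℕ), 0 < k → (hr : r0 + k ≤ n) → (hc : c0 + k ≤ m) →
      0 < (X.submatrix
        (fun i : Fin k => (⟨r0 + i.1,
          Nat.lt_of_lt_of_le (Nat.add_lt_add_left i.isLt r0) hr⟩ : Fin n))
        (fun j : Fin k => (⟨c0 + j.1,
          Nat.lt_of_lt_of_le (Nat.add_lt_add_left j.isLt c0) hc⟩ : Fin m))).det) :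
    IsStrictlyTotallyPositive X := by
  intro k r c hr hc
  set Y : ℕ → ℕ → ℝ := fun i j =>
    if hi : i < n then if hj : j < m then X ⟨i, hi⟩ ⟨j, hj⟩ else 0 else 0 with hY
  have hYX : ∀ (i : Fin n) (j : Fin m), Y i j = X i j := by
    intro i j
    simp [hY]
  have key := all_pos n m Y ?_ k (fun i => (r i : ℕ)) (fun j => (c j : ℕ))
    (fun _ _ hab => hr hab) (fun i => (r i).isLt) (fun _ _ hab => hc hab) (fun j => (c j).isLt)
  · simp only [hYX] at key
    exact key
  · intro k r0 c0 hrk hck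
    rcases Nat.eq_zero_or_pos k with rfl | hk
    · simp
    · have := h k r0 c0 hk hrk hck
      convert this using 2
      ext i j
      exact hYX ⟨r0 + i.1, Nat.lt_of_lt_of_le (Nat.add_lt_add_left i.isLt r0) hrk⟩
        ⟨c0 + j.1, Nat.lt_of_lt_of_le (Nat.add_lt_add_left j.isLt c0) hck⟩
end
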